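/- arXiv:1907.12031 — 2 statements merged into one kernel-verified Lean document; each statement's English description precedes it below -/
import Mathlib

section
/- (Asymptotic compatibility.) Let Ω ⊂ ℝ^d be bounded, open and connected, let δ₀ > 0, M > 0, and fix ĥ ∈ (0,1]^d with maximum component 1. Then there exists C > 0 depending only on Ω, δ₀, ĥ, ρ, d and M such that the following holds for every δ ∈ (0, δ₀] and every h = h_max ĥ: if u⁰ ∈ C⁴(ℝ^d) vanishes on ℝ^d \ Ω with sup_{|β|≤4} sup_y |D^β u⁰(y)| ≤ M, if f₀ := −Δu⁰ on Ω, if f_δ : Ω → ℝ satisfies sup_{x∈Ω} |f_δ(x) − f₀(x)| ≤ M δ², and if u^{δ,h} ∈ S(□∩Ω) satisfies the collocation equations −L_δ u^{δ,h}(x_k) = f_δ(x_k) for every grid point x_k ∈ Ω, then ‖u⁰ − u^{δ,h}‖_{L²(Ω)} ≤ C (h_max² + δ²). -/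
open MeasureTheory Real
open scoped BigOperators

noncomputable section

/-- The cubic B-spline window function. -/
def phi (x : ℝ) : ℝ :=
  if x ≤ 1/2 then 2/3 - 4*x^2 + 4*x^3
  else if x ≤ 1 then (4/3)*(1-x)^3
  else 0

/-- Grid point `x_k = (k₁h₁, …, k_d h_d)`. -/
def gridPt (d : ℕ) (h : Fin d → ℝ) (k : Fin d → ℤ) : EuclideanSpace ℝ (Fin d) :=
  (EuclideanSpace.equiv (Fin d) ℝ).symm (fun j => (k j : ℝ) * h j)

/-- Linear RK basis function `Ψ_k`. -/
def Psi (d : ℕ) (h : Fin d → ℝ) (k : Fin d → ℤ) (x : EuclideanSpace ℝ (Fin d)) : ℝ :=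
  ∏ j, phi (|x j - (k j : ℝ) * h j| / (2 * h j))

/-- The RK function `i^h(c) = Σ_k Ψ_k c_k` with coefficient sequence `c`. -/
def RKfun (d : ℕ) (h : Fin d → ℝ) (c : (Fin d → ℤ) → ℝ) (x : EuclideanSpace ℝ (Fin d)) : ℝ :=
  ∑' k : Fin d → ℤ, Psi d h k x * c k

/-- The rescaled kernel `ρ_δ(r) = δ^{-(d+2)} ρ(r/δ)`. -/
def rhoScaled (d : ℕ) (ρ : ℝ → ℝ) (δ : ℝ) (r : ℝ) : ℝ :=
  (δ ^ (d + 2))⁻¹ * ρ (r / δ)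

/-- The nonlocal diffusion operator `L_δ`. -/
def nonlocalOp (d : ℕ) (ρ : ℝ → ℝ) (δ : ℝ) (u : EuclideanSpace ℝ (Fin d) → ℝ)
    (x : EuclideanSpace ℝ (Fin d)) : ℝ :=
  ∫ s in Metric.ball (0 : EuclideanSpace ℝ (Fin d)) δ,
    rhoScaled d ρ δ ‖s‖ * (u (x + s) - u x)

/-- First-order partial derivative in the `j`-th coordinate direction. -/
def pderiv1 (d : ℕ) (j : Fin d) (u : EuclideanSpace ℝ (Fin d) → ℝ) :
    EuclideanSpace ℝ (Fin d) → ℝ :=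
  fun x => fderiv ℝ u x (EuclideanSpace.single j (1:ℝ))

/-- Multi-index partial derivative `D^α = ∂₁^{α₁} ⋯ ∂_d^{α_d}`. -/
def multiDeriv (d : ℕ) (α : Fin d → ℕ) (u : EuclideanSpace ℝ (Fin d) → ℝ) :
    EuclideanSpace ℝ (Fin d) → ℝ :=
  (List.finRange d).foldr (fun j v => (pderiv1 d j)^[α j] v) u

/-- The Laplacian `Δu = Σ_j ∂²u/∂x_j²`. -/
def laplacian (d : ℕ) (u : EuclideanSpace ℝ (Fin d) → ℝ)
    (x : EuclideanSpace ℝ (Fin d)) : ℝ :=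
  ∑ j, pderiv1 d j (pderiv1 d j u) x

section part1

def B1 (t : ℝ) : ℝ := (|t+2|^3 - 4*|t+1|^3 + 6*|t|^3 - 4*|t-1|^3 + |t-2|^3)/12
def B1' (t : ℝ) : ℝ := ((t+2)*|t+2| - 4*((t+1)*|t+1|) + 6*(t*|t|) - 4*((t-1)*|t-1|) + (t-2)*|t-2|)/4
def B1'' (t : ℝ) : ℝ := (|t+2| - 4*|t+1| + 6*|t| - 4*|t-1| + |t-2|)/2

lemma phi_eq (t : ℝ) : phi (|t|/2) = B1 t := by
  unfold phi B1
  rcases abs_cases t with ⟨h, h'⟩ | ⟨h, h'⟩ <;>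
  rcases abs_cases (t+2) with ⟨h2, h2'⟩ | ⟨h2, h2'⟩ <;>
  rcases abs_cases (t+1) with ⟨h3, h3'⟩ | ⟨h3, h3'⟩ <;>
  rcases abs_cases (t-1) with ⟨h4, h4'⟩ | ⟨h4, h4'⟩ <;>
  rcases abs_cases (t-2) with ⟨h5, h5'⟩ | ⟨h5, h5'⟩ <;>
  rw [h, h2, h3, h4, h5] <;> split_ifs <;>
  first
  | (exfalso; linarith)
  | ring1
  | (have e : t = 1 := by linarith
     subst e; norm_num)
  | (have e : t = 2 := by linarith
     subst e; norm_num)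

lemma hda_of {f g : ℝ → ℝ} {f' g' t : ℝ} (h : HasDerivAt f f' t) (e : ∀ x, g x = f x)
    (e' : g' = f') : HasDerivAt g g' t := by
  have : g = f := funext e
  rw [this, e']; exact h

lemma hasDerivAt_mul_abs (t : ℝ) : HasDerivAt (fun t : ℝ => t * |t|) (2*|t|) t := by
  rcases lt_trichotomy t 0 with h | h | h
  · have : HasDerivAt (fun t : ℝ => t * (-t)) (2*|t|) t := by
      rw [abs_of_neg h]
      refine hda_of ((hasDerivAt_id t).mul (hasDerivAt_id t).neg) (fun x => by simp) ?_
      simp; ring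
    refine this.congr_of_eventuallyEq ?_
    filter_upwards [Iio_mem_nhds h] with y hy
    rw [abs_of_neg hy]
  · subst h
    rw [hasDerivAt_iff_isLittleO_nhds_zero]
    simp only [zero_add, abs_zero, mul_zero, sub_zero, smul_zero]
    rw [Asymptotics.isLittleO_iff]
    intro c hc
    filter_upwards [Metric.ball_mem_nhds (0:ℝ) hc] with y hy
    simp at hy
    simp only [norm_eq_abs, abs_mul, abs_abs]
    nlinarith [abs_nonneg y]
  · have : HasDerivAt (fun t : ℝ => t * t) (2*|t|) t := by
      rw [abs_of_pos h]
      refine hda_of ((hasDerivAt_id t).mul (hasDerivAt_id t)) (fun x => by simp) ?_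
      simp; ring
    refine this.congr_of_eventuallyEq ?_
    filter_upwards [Ioi_mem_nhds h] with y hy
    rw [abs_of_pos hy]

lemma hasDerivAt_abs_cube (t : ℝ) : HasDerivAt (fun t : ℝ => |t|^3) (3*(t*|t|)) t := by
  have := (hasDerivAt_id t).mul (hasDerivAt_mul_abs t)
  have e : (fun t : ℝ => |t|^3) = (fun t => t * (t*|t|)) := by
    funext t
    rw [pow_succ, sq_abs]; ring
  rw [e]
  refine hda_of this (fun x => by simp) ?_
  simp; ring

lemma hda_shift {f : ℝ → ℝ} {f' : ℝ → ℝ} (h : ∀ t, HasDerivAt f (f' t) t) (a t : ℝ) :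
    HasDerivAt (fun t => f (t + a)) (f' (t + a)) t := by
  simpa using (h (t+a)).comp_add_const t a

lemma hasDerivAt_B1 (t : ℝ) : HasDerivAt B1 (B1' t) t := by
  have h := fun a => hda_shift hasDerivAt_abs_cube a t
  have := ((((h 2).sub ((h 1).const_mul 4)).add ((h 0).const_mul 6)).sub
    ((h (-1)).const_mul 4)).add (h (-2))
  refine hda_of (this.div_const 12) (fun x => ?_) ?_
  · simp [B1, sub_eq_add_neg]
  · simp [B1', sub_eq_add_neg]; ring

lemma hasDerivAt_B1' (t : ℝ) : HasDerivAt B1' (B1'' t) t := by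
  have h := fun a => hda_shift hasDerivAt_mul_abs a t
  have := ((((h 2).sub ((h 1).const_mul 4)).add ((h 0).const_mul 6)).sub
    ((h (-1)).const_mul 4)).add (h (-2))
  refine hda_of (this.div_const 4) (fun x => ?_) ?_
  · simp [B1', sub_eq_add_neg]
  · simp [B1'', sub_eq_add_neg]; ring

lemma B1''_bound (t : ℝ) : |B1'' t| ≤ 2 := by
  unfold B1''
  rw [abs_le]
  rcases abs_cases t with ⟨h, h'⟩ | ⟨h, h'⟩ <;>
  rcases abs_cases (t+2) with ⟨h2, h2'⟩ | ⟨h2, h2'⟩ <;>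
  rcases abs_cases (t+1) with ⟨h3, h3'⟩ | ⟨h3, h3'⟩ <;>
  rcases abs_cases (t-1) with ⟨h4, h4'⟩ | ⟨h4, h4'⟩ <;>
  rcases abs_cases (t-2) with ⟨h5, h5'⟩ | ⟨h5, h5'⟩ <;>
  rw [h, h2, h3, h4, h5] <;> constructor <;> linarith

lemma B1'_lip (a b : ℝ) : |B1' a - B1' b| ≤ 2 * |a - b| := by
  have := (convex_univ (𝕜 := ℝ) (E := ℝ)).norm_image_sub_le_of_norm_hasDerivWithin_le
    (f := B1') (f' := B1'') (C := 2) (fun x _ => (hasDerivAt_B1' x).hasDerivWithinAt)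
    (fun x _ => B1''_bound x) (Set.mem_univ b) (Set.mem_univ a)
  simpa using this

lemma B1_zero {t : ℝ} (ht : 2 ≤ |t|) : B1 t = 0 := by
  rw [← phi_eq]
  unfold phi
  split_ifs with h1 h2
  · linarith
  · have : |t|/2 = 1 := by linarith
    rw [this]; norm_num
  · rfl

lemma B1_nonneg (t : ℝ) : 0 ≤ B1 t := by
  rw [← phi_eq]
  have := abs_nonneg t
  unfold phi
  split_ifs with h1 h2
  · nlinarith [mul_nonneg this this, mul_nonneg (mul_nonneg this this) this]
  · have : 0 ≤ 1 - |t|/2 := by linarith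
    positivity
  · rfl

lemma B1_le_one (t : ℝ) : B1 t ≤ 1 := by
  rw [← phi_eq]
  have := abs_nonneg t
  unfold phi
  split_ifs with h1 h2
  · nlinarith [mul_nonneg this this, mul_nonneg (mul_nonneg this this) this]
  · have h3 : 0 ≤ 1 - |t|/2 := by linarith
    have h4 : 1 - |t|/2 ≤ 1/2 := by linarith
    have : (1 - |t|/2)^3 ≤ (1/2)^3 := by gcongr
    linarith
  · norm_num

lemma B1_neg (t : ℝ) : B1 (-t) = B1 t := by rw [← phi_eq, ← phi_eq, abs_neg]

lemma B1'_bound (t : ℝ) : |B1' t| ≤ 8 := by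
  by_cases h : |t| ≤ 2
  · have := B1'_lip t 2
    have h0 : B1' 2 = 0 := by unfold B1'; norm_num
    rw [h0, sub_zero] at this
    have : |t - 2| ≤ 4 := by rw [abs_le] at *; constructor <;> linarith
    linarith
  · have h0 : B1' t = 0 := by
      unfold B1'
      rcases abs_cases t with ⟨h1, h'⟩ | ⟨h1, h'⟩
      · rw [abs_of_nonneg, abs_of_nonneg, abs_of_nonneg, abs_of_nonneg, abs_of_nonneg] <;> linarith
      · rw [abs_of_nonpos, abs_of_nonpos, abs_of_nonpos, abs_of_nonpos, abs_of_nonpos] <;> linarith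
    rw [h0]; norm_num

lemma B1_lip (a b : ℝ) : |B1 a - B1 b| ≤ 8 * |a - b| := by
  have := (convex_univ (𝕜 := ℝ) (E := ℝ)).norm_image_sub_le_of_norm_hasDerivWithin_le
    (f := B1) (f' := B1') (C := 8) (fun x _ => (hasDerivAt_B1 x).hasDerivWithinAt)
    (fun x _ => B1'_bound x) (Set.mem_univ b) (Set.mem_univ a)
  simpa using this

lemma B1_second (t s : ℝ) : |B1 (t+s) + B1 (t-s) - 2 * B1 t| ≤ 8 * s^2 := by
  have key : ∀ s : ℝ, HasDerivAt (fun s => B1 (t+s) + B1 (t-s)) (B1' (t+s) - B1' (t-s)) s := by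
    intro s
    have h1 : HasDerivAt (fun s => B1 (t+s)) (B1' (t+s)) s := by
      simpa using (hasDerivAt_B1 (t+s)).comp_const_add t s
    have h2 : HasDerivAt (fun s => B1 (t-s)) (-B1' (t-s)) s := by
      simpa using (hasDerivAt_B1 (t-s)).comp_const_sub t s
    exact hda_of (h1.add h2) (fun x => by simp) (by ring)
  have := (convex_Icc (-|s|) |s|).norm_image_sub_le_of_norm_hasDerivWithin_le
    (f := fun s => B1 (t+s) + B1 (t-s)) (f' := fun s => B1' (t+s) - B1' (t-s)) (C := 4*|s|)
    (fun x _ => (key x).hasDerivWithinAt)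
    (fun x hx => by
      have := B1'_lip (t+x) (t-x)
      rw [show t + x - (t - x) = 2 * x by ring, abs_mul, abs_two] at this
      have h2 : |x| ≤ |s| := abs_le.2 hx
      simp only [norm_eq_abs]
      linarith) (x := 0) (y := s)
    (by simp) (by simp [neg_abs_le, le_abs_self])
  simp only [norm_eq_abs, add_zero, sub_zero] at this
  rw [show B1 (t+s) + B1 (t-s) - 2 * B1 t = B1 (t+s) + B1 (t-s) - (B1 t + B1 t) by ring]
  calc _ ≤ _ := this
    _ = 4 * s^2 := by rw [mul_assoc, abs_mul_abs_self]; ring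
    _ ≤ _ := by nlinarith [sq_nonneg s]

lemma continuous_B1 : Continuous B1 := by unfold B1; fun_prop

/-- moments -/
def mom : ℕ → ℝ
  | 0 => 1
  | 2 => 1/3
  | _ => 0

lemma B1_mom_aux (θ : ℝ) (h0 : 0 ≤ θ) (h1 : θ < 1) (m : ℕ) (hm : m ≤ 3) :
    B1 (θ+1) * (-1-θ)^m + B1 θ * (-θ)^m + B1 (θ-1) * (1-θ)^m + B1 (θ-2) * (2-θ)^m = mom m := by
  have e1 : B1 (θ+1) = (1-θ)^3/6 := by
    unfold B1
    rw [abs_of_nonneg (by linarith), abs_of_nonneg (by linarith), abs_of_nonneg (by linarith),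
      abs_of_nonneg (by linarith), abs_of_nonpos (by linarith)]
    ring
  have e2 : B1 θ = 2/3 - θ^2 + θ^3/2 := by
    unfold B1
    rw [abs_of_nonneg (by linarith), abs_of_nonneg (by linarith), abs_of_nonneg (by linarith),
      abs_of_nonpos (by linarith), abs_of_nonpos (by linarith)]
    ring
  have e3 : B1 (θ-1) = 2/3 - (1-θ)^2 + (1-θ)^3/2 := by
    unfold B1
    rw [abs_of_nonneg (by linarith), abs_of_nonneg (by linarith), abs_of_nonpos (by linarith),
      abs_of_nonpos (by linarith), abs_of_nonpos (by linarith)]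
    ring
  have e4 : B1 (θ-2) = θ^3/6 := by
    unfold B1
    rw [abs_of_nonneg (by linarith), abs_of_nonpos (by linarith), abs_of_nonpos (by linarith),
      abs_of_nonpos (by linarith), abs_of_nonpos (by linarith)]
    ring
  rw [e1, e2, e3, e4]
  interval_cases m <;> simp only [mom] <;> ring

lemma B1_mom (t : ℝ) (m : ℕ) (hm : m ≤ 3) (S : Finset ℤ)
    (hS : ∀ k : ℤ, |t - k| < 2 → k ∈ S) :
    ∑ k ∈ S, B1 (t - k) * (k - t)^m = mom m := by
  have hS' : ∑ k ∈ S, B1 (t - k) * (k - t)^m =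
      ∑ k ∈ Finset.Icc (⌊t⌋ - 1) (⌊t⌋ + 2), B1 (t - k) * (k - t)^m := by
    have h1 : ∑ k ∈ S ∪ Finset.Icc (⌊t⌋ - 1) (⌊t⌋ + 2), B1 (t - k) * (k - t)^m =
        ∑ k ∈ S, B1 (t - k) * (k - t)^m := by
      symm
      apply Finset.sum_subset Finset.subset_union_left
      intro k _ hk
      rw [B1_zero, zero_mul]
      by_contra hc
      exact hk (hS k (not_le.1 hc))
    rw [← h1]
    symm
    apply Finset.sum_subset Finset.subset_union_right
    intro k _ hk
    rw [B1_zero, zero_mul]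
    have hf := Int.floor_le t
    have hf2 := Int.lt_floor_add_one t
    simp only [Finset.mem_Icc, not_and_or, not_le] at hk
    rcases hk with hk | hk
    · have : k + 2 ≤ ⌊t⌋ := by omega
      have : (k:ℝ) + 2 ≤ ⌊t⌋ := by exact_mod_cast this
      exact le_trans (by linarith) (le_abs_self _)
    · have : ⌊t⌋ + 3 ≤ k := by omega
      have : (⌊t⌋:ℝ) + 3 ≤ k := by exact_mod_cast this
      exact le_trans (by linarith) (neg_le_abs _)
  rw [hS']
  have hI : Finset.Icc (⌊t⌋ - 1) (⌊t⌋ + 2) = {⌊t⌋ - 1, ⌊t⌋, ⌊t⌋ + 1, ⌊t⌋ + 2} := by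
    ext k; simp only [Finset.mem_Icc, Finset.mem_insert, Finset.mem_singleton]; omega
  rw [hI, Finset.sum_insert (by simp; omega), Finset.sum_insert (by simp),
    Finset.sum_insert (by simp), Finset.sum_singleton]
  rw [← B1_mom_aux (Int.fract t) (Int.fract_nonneg t) (Int.fract_lt_one t) m hm]
  have : t = ⌊t⌋ + Int.fract t := (Int.floor_add_fract t).symm
  have e : Int.fract t = t - ⌊t⌋ := rfl
  rw [e]
  push_cast
  ring_nf

end part1

section part2

def hat (x : ℝ) : ℝ := (|x+1| + |x-1| - 2*|x|)/2
def GG (x : ℝ) : ℝ := (|x+1|^3 + |x-1|^3 - 2*|x|^3)/12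
def GG' (x : ℝ) : ℝ := ((x+1)*|x+1| + (x-1)*|x-1| - 2*(x*|x|))/4

lemma hasDerivAt_GG (t : ℝ) : HasDerivAt GG (GG' t) t := by
  have h := fun a => hda_shift hasDerivAt_abs_cube a t
  have := ((h 1).add (h (-1))).sub ((h 0).const_mul 2)
  refine hda_of (this.div_const 12) (fun x => ?_) ?_
  · simp [GG, sub_eq_add_neg]
  · simp [GG', sub_eq_add_neg]; ring

lemma hasDerivAt_GG' (t : ℝ) : HasDerivAt GG' (hat t) t := by
  have h := fun a => hda_shift hasDerivAt_mul_abs a t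
  have := ((h 1).add (h (-1))).sub ((h 0).const_mul 2)
  refine hda_of (this.div_const 4) (fun x => ?_) ?_
  · simp [GG', sub_eq_add_neg]
  · simp [hat, sub_eq_add_neg]; ring

lemma continuous_hat : Continuous hat := by unfold hat; fun_prop

lemma hat_zero {x : ℝ} (hx : 1 ≤ |x|) : hat x = 0 := by
  unfold hat
  rcases abs_cases x with ⟨h1, h'⟩ | ⟨h1, h'⟩
  · rw [abs_of_nonneg, abs_of_nonneg, abs_of_nonneg] <;> linarith
  · rw [abs_of_nonpos, abs_of_nonpos, abs_of_nonpos] <;> linarith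

lemma hat_pos {x : ℝ} (h0 : 0 ≤ x) (h1 : x ≤ 1) : hat x = 1 - x := by
  unfold hat
  rw [abs_of_nonneg (by linarith), abs_of_nonpos (by linarith), abs_of_nonneg h0]; ring

lemma hat_neg {x : ℝ} (h0 : -1 ≤ x) (h1 : x ≤ 0) : hat x = 1 + x := by
  unfold hat
  rw [abs_of_nonneg (by linarith), abs_of_nonpos (by linarith), abs_of_nonpos h1]; ring

lemma hat_abs_le (x : ℝ) : |hat x| ≤ 1 := by
  by_cases h : 1 ≤ |x|
  · rw [hat_zero h]; simp
  · push Not at h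
    rw [abs_lt] at h
    rcases le_total 0 x with hx | hx
    · rw [hat_pos hx h.2.le, abs_le]; constructor <;> linarith
    · rw [hat_neg h.1.le hx, abs_le]; constructor <;> linarith

lemma hat_support : Function.support hat ⊆ Set.Ioc (-1) 1 := by
  intro x hx
  by_contra hc
  apply hx
  apply hat_zero
  rw [le_abs]
  simp only [Set.mem_Ioc, not_and_or, not_lt, not_le] at hc
  rcases hc with h | h
  · right; linarith
  · left; linarith

lemma integrable_hat : Integrable hat := by
  apply continuous_hat.integrable_of_hasCompactSupport
  apply HasCompactSupport.of_support_subset_isCompact (K := Set.Icc (-1) 1) isCompact_Icc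
  exact hat_support.trans Set.Ioc_subset_Icc_self

lemma hat_conv (t : ℝ) : ∫ x, hat x * hat (x + t) = B1 t := by
  have hs : Function.support (fun x => hat x * hat (x + t)) ⊆ Set.Ioc (-1) 1 := by
    refine Set.Subset.trans ?_ hat_support
    intro x hx h0
    exact hx (by simp [h0])
  rw [← intervalIntegral.integral_eq_integral_of_support_subset hs]
  have hc : Continuous (fun x => hat x * hat (x + t)) := by
    have := continuous_hat
    fun_prop
  rw [← intervalIntegral.integral_add_adjacent_intervals (b := 0) (hc.intervalIntegrable _ _)
    (hc.intervalIntegrable _ _)]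
  have hch : Continuous (fun x => hat (x + t)) := continuous_hat.comp (by fun_prop)
  have e1 : ∫ x in (-1:ℝ)..0, hat x * hat (x + t) = ∫ x in (-1:ℝ)..0, (1 + x) * hat (x + t) := by
    apply intervalIntegral.integral_congr
    intro x hx
    rw [Set.uIcc_of_le (by norm_num)] at hx
    simp only [hat_neg hx.1 hx.2]
  have e2 : ∫ x in (0:ℝ)..1, hat x * hat (x + t) = ∫ x in (0:ℝ)..1, (1 - x) * hat (x + t) := by
    apply intervalIntegral.integral_congr
    intro x hx
    rw [Set.uIcc_of_le (by norm_num)] at hx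
    simp only [hat_pos hx.1 hx.2]
  rw [e1, e2]
  rw [intervalIntegral.integral_eq_sub_of_hasDerivAt (f := fun x => (1 + x) * GG' (x + t) - GG (x + t)),
    intervalIntegral.integral_eq_sub_of_hasDerivAt (f := fun x => (1 - x) * GG' (x + t) + GG (x + t))]
  · simp only [B1, GG, GG']
    ring_nf
  · intro x _
    refine hda_of ((((hasDerivAt_id x).const_sub 1).mul (hda_shift hasDerivAt_GG' t x)).add
      (hda_shift hasDerivAt_GG t x)) (fun x => by simp) ?_
    simp
  · exact ((by fun_prop : Continuous fun x : ℝ => 1 - x).mul hch).intervalIntegrable _ _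
  · intro x _
    refine hda_of ((((hasDerivAt_id x).const_add 1).mul (hda_shift hasDerivAt_GG' t x)).sub
      (hda_shift hasDerivAt_GG t x)) (fun x => by simp) ?_
    simp
  · exact ((by fun_prop : Continuous fun x : ℝ => 1 + x).mul hch).intervalIntegrable _ _

/-- dual function -/
def dl (x : ℝ) : ℝ := Set.indicator (Set.Ioc 0 1) (fun x => 4 - 6 * x) x

lemma integrable_dl : Integrable dl := by
  unfold dl
  rw [show (fun x => Set.indicator (Set.Ioc (0:ℝ) 1) (fun x : ℝ => 4 - 6 * x) x) =
    Set.indicator (Set.Ioc (0:ℝ) 1) (fun x : ℝ => 4 - 6 * x) from rfl,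
    integrable_indicator_iff measurableSet_Ioc]
  exact (by fun_prop : Continuous fun x : ℝ => 4 - 6 * x).integrableOn_Ioc

lemma dl_abs_le (x : ℝ) : |dl x| ≤ 4 := by
  unfold dl
  by_cases h : x ∈ Set.Ioc (0:ℝ) 1
  · rw [Set.indicator_of_mem h, abs_le]
    constructor <;> linarith [h.1, h.2]
  · rw [Set.indicator_of_notMem h]; simp

lemma int_dl_mul (f : ℝ → ℝ) : ∫ x, dl x * f x = ∫ x in (0:ℝ)..1, (4 - 6 * x) * f x := by
  rw [intervalIntegral.integral_of_le zero_le_one, ← integral_indicator measurableSet_Ioc]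
  congr 1
  funext x
  unfold dl
  by_cases h : x ∈ Set.Ioc (0:ℝ) 1
  · simp [Set.indicator_of_mem h]
  · simp [Set.indicator_of_notMem h]

lemma dl_hat (m : ℤ) : ∫ x, dl x * hat (x + m) = if m = 0 then 1 else 0 := by
  rw [int_dl_mul]
  by_cases h0 : m = 0
  · subst h0
    rw [if_pos rfl]
    have : ∫ x in (0:ℝ)..1, (4 - 6 * x) * hat (x + (0:ℤ)) =
        ∫ x in (0:ℝ)..1, (4 - 10 * x + 6 * x ^ 2) := by
      apply intervalIntegral.integral_congr
      intro x hx
      rw [Set.uIcc_of_le (by norm_num)] at hx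
      simp only [Int.cast_zero, add_zero, hat_pos hx.1 hx.2]; ring
    rw [this, intervalIntegral.integral_eq_sub_of_hasDerivAt
      (f := fun x => 4 * x - 5 * x^2 + 2 * x^3)]
    · norm_num
    · intro x _
      refine hda_of ((((hasDerivAt_id x).const_mul 4).sub ((hasDerivAt_pow 2 x).const_mul 5)).add
        ((hasDerivAt_pow 3 x).const_mul 2)) (fun x => by simp) ?_
      simp; ring
    · exact (by fun_prop : Continuous _).intervalIntegrable _ _
  rw [if_neg h0]
  by_cases h1 : m = -1
  · subst h1
    have : ∫ x in (0:ℝ)..1, (4 - 6 * x) * hat (x + (-1:ℤ)) =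
        ∫ x in (0:ℝ)..1, (4 * x - 6 * x ^ 2) := by
      apply intervalIntegral.integral_congr
      intro x hx
      rw [Set.uIcc_of_le (by norm_num)] at hx
      simp only [Int.cast_neg, Int.cast_one]
      rw [hat_neg (by linarith [hx.1]) (by linarith [hx.2])]; ring
    rw [this, intervalIntegral.integral_eq_sub_of_hasDerivAt
      (f := fun x => 2 * x^2 - 2 * x^3)]
    · norm_num
    · intro x _
      refine hda_of (((hasDerivAt_pow 2 x).const_mul 2).sub
        ((hasDerivAt_pow 3 x).const_mul 2)) (fun x => by simp) ?_
      simp; ring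
    · exact (by fun_prop : Continuous _).intervalIntegrable _ _
  · have : ∫ x in (0:ℝ)..1, (4 - 6 * x) * hat (x + m) = ∫ x in (0:ℝ)..1, (0:ℝ) := by
      apply intervalIntegral.integral_congr
      intro x hx
      rw [Set.uIcc_of_le (by norm_num)] at hx
      simp only
      rw [hat_zero, mul_zero]
      rcases (by omega : 1 ≤ m ∨ m ≤ -2) with h | h
      · have : (1:ℝ) ≤ m := by exact_mod_cast h
        exact le_trans (by linarith [hx.1]) (le_abs_self _)
      · have : (m:ℝ) ≤ -2 := by exact_mod_cast h
        exact le_trans (by linarith [hx.2]) (neg_le_abs _)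
    rw [this]; simp

lemma dl_dl (m : ℤ) : ∫ x, dl x * dl (x + m) = if m = 0 then 4 else 0 := by
  by_cases h0 : m = 0
  · subst h0
    rw [if_pos rfl]
    have : ∫ x, dl x * dl (x + (0:ℤ)) = ∫ x, dl x * (4 - 6 * x) := by
      congr 1
      funext x
      unfold dl
      by_cases h : x ∈ Set.Ioc (0:ℝ) 1
      · simp [Set.indicator_of_mem h]
      · simp [Set.indicator_of_notMem h]
    rw [this, int_dl_mul]
    rw [intervalIntegral.integral_eq_sub_of_hasDerivAt
      (f := fun x => 16 * x - 24 * x^2 + 12 * x^3)]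
    · norm_num
    · intro x _
      refine hda_of ((((hasDerivAt_id x).const_mul 16).sub ((hasDerivAt_pow 2 x).const_mul 24)).add
        ((hasDerivAt_pow 3 x).const_mul 12)) (fun x => by simp) ?_
      simp; ring
    · exact (by fun_prop : Continuous _).intervalIntegrable _ _
  rw [if_neg h0]
  have : ∀ x, dl x * dl (x + m) = 0 := by
    intro x
    unfold dl
    by_cases h : x ∈ Set.Ioc (0:ℝ) 1
    · by_cases h' : x + m ∈ Set.Ioc (0:ℝ) 1
      · exfalso
        apply h0
        have a1 : (m:ℝ) < 1 := by linarith [h.1, h'.2]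
        have a2 : (-1:ℝ) < m := by linarith [h.2, h'.1]
        have a1 : m < 1 := by exact_mod_cast a1
        have a2 : -1 < m := by exact_mod_cast a2
        omega
      · rw [Set.indicator_of_notMem h', mul_zero]
    · rw [Set.indicator_of_notMem h, zero_mul]
  simp [this]

lemma int_scale (f g : ℝ → ℝ) (h : ℝ) (hh : 0 < h) (a b : ℝ) :
    ∫ x, f (x / h - a) * g (x / h - b) = h * ∫ x, f x * g (x + (a - b)) := by
  have := Measure.integral_comp_div (fun y => f (y - a) * g (y - b)) h
  rw [this, abs_of_pos hh, smul_eq_mul]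
  congr 1
  rw [← integral_add_right_eq_self _ a]
  congr 1
  funext x
  congr 2 <;> ring

lemma integrable_scale (f g : ℝ → ℝ) (hf : Integrable f) (hg : Integrable g) (C : ℝ)
    (hgb : ∀ x, |g x| ≤ C) (h : ℝ) (hh : 0 < h) (a b : ℝ) :
    Integrable (fun x => f (x / h - a) * g (x / h - b)) := by
  have hf' : Integrable (fun x => f (x / h - a)) :=
    (hf.comp_sub_right a).comp_div hh.ne'
  have hg' : Integrable (fun x => g (x / h - b)) :=
    (hg.comp_sub_right b).comp_div hh.ne'
  exact hf'.mul_bdd hg'.aestronglyMeasurable (Filter.Eventually.of_forall fun x => hgb _)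

variable {d : ℕ}

lemma integrable_prodE (f : Fin d → ℝ → ℝ) (hf : ∀ i, Integrable (f i)) :
    Integrable (fun x : EuclideanSpace ℝ (Fin d) => ∏ i, f i (x i)) := by
  have := Integrable.fintype_prod (f := f) (μ := fun _ => volume) hf
  exact ((EuclideanSpace.volume_preserving_symm_measurableEquiv_toLp (Fin d)).integrable_comp_emb
    (MeasurableEquiv.measurableEmbedding _)).2 this

lemma integral_prodE (f : Fin d → ℝ → ℝ) :
    ∫ x : EuclideanSpace ℝ (Fin d), ∏ i, f i (x i) = ∏ i, ∫ x, f i x := by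
  rw [← integral_fintype_prod_volume_eq_prod (fun i => f i)]
  exact (EuclideanSpace.volume_preserving_symm_measurableEquiv_toLp (Fin d)).integral_comp
    (MeasurableEquiv.measurableEmbedding _) (fun y => ∏ i, f i (y i))

def Tk (h : Fin d → ℝ) (k : Fin d → ℤ) (x : EuclideanSpace ℝ (Fin d)) : ℝ :=
  ∏ i, hat (x i / h i - k i)
def Dk (h : Fin d → ℝ) (k : Fin d → ℤ) (x : EuclideanSpace ℝ (Fin d)) : ℝ :=
  ∏ i, dl (x i / h i - k i)

lemma Tk_mul_shift (h : Fin d → ℝ) (k j : Fin d → ℤ) (s x : EuclideanSpace ℝ (Fin d)) :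
    Tk h k x * Tk h j (x + s) =
    ∏ i, (hat (x i / h i - k i) * hat (x i / h i - (j i - s i / h i))) := by
  unfold Tk
  rw [← Finset.prod_mul_distrib]
  congr 1; funext i
  congr 2
  simp; ring

lemma TT_integrable (h : Fin d → ℝ) (hh : ∀ i, 0 < h i) (k j : Fin d → ℤ)
    (s : EuclideanSpace ℝ (Fin d)) :
    Integrable (fun x => Tk h k x * Tk h j (x + s)) := by
  simp_rw [Tk_mul_shift]
  apply integrable_prodE (fun i x => hat (x / h i - k i) * hat (x / h i - (j i - s i / h i)))
  intro i
  exact integrable_scale hat hat integrable_hat integrable_hat 1 hat_abs_le _ (hh i) _ _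

lemma TT_integral (h : Fin d → ℝ) (hh : ∀ i, 0 < h i) (k j : Fin d → ℤ)
    (s : EuclideanSpace ℝ (Fin d)) :
    ∫ x, Tk h k x * Tk h j (x + s) = (∏ i, h i) * ∏ i, B1 (k i - j i + s i / h i) := by
  simp_rw [Tk_mul_shift]
  rw [integral_prodE (fun i x => hat (x / h i - k i) * hat (x / h i - (j i - s i / h i))),
    ← Finset.prod_mul_distrib]
  congr 1; funext i
  rw [int_scale _ _ _ (hh i), hat_conv]
  congr 2; ring

lemma DT_integrable (h : Fin d → ℝ) (hh : ∀ i, 0 < h i) (k j : Fin d → ℤ) :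
    Integrable (fun x => Dk h k x * Tk h j x) := by
  unfold Tk Dk
  simp_rw [← Finset.prod_mul_distrib]
  apply integrable_prodE (fun i x => dl (x / h i - k i) * hat (x / h i - j i))
  intro i
  exact integrable_scale dl hat integrable_dl integrable_hat 1 hat_abs_le _ (hh i) _ _

lemma DD_integrable (h : Fin d → ℝ) (hh : ∀ i, 0 < h i) (k j : Fin d → ℤ) :
    Integrable (fun x => Dk h k x * Dk h j x) := by
  unfold Dk
  simp_rw [← Finset.prod_mul_distrib]
  apply integrable_prodE (fun i x => dl (x / h i - k i) * dl (x / h i - j i))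
  intro i
  exact integrable_scale dl dl integrable_dl integrable_dl 4 dl_abs_le _ (hh i) _ _

lemma prod_ite_eq' (k j : Fin d → ℤ) (c : ℝ) :
    ∏ i, (if k i - j i = 0 then c else 0) = if k = j then c ^ d else 0 := by
  by_cases h : k = j
  · simp [h]
  · rw [if_neg h]
    obtain ⟨i, hi⟩ := Function.ne_iff.1 h
    exact Finset.prod_eq_zero (Finset.mem_univ i) (by rw [if_neg (sub_ne_zero.2 hi)])

lemma DT_integral (h : Fin d → ℝ) (hh : ∀ i, 0 < h i) (k j : Fin d → ℤ) :
    ∫ x, Dk h k x * Tk h j x = (∏ i, h i) * if k = j then 1 else 0 := by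
  unfold Tk Dk
  simp_rw [← Finset.prod_mul_distrib]
  rw [integral_prodE (fun i x => dl (x / h i - k i) * hat (x / h i - j i))]
  have := prod_ite_eq' k j 1
  rw [one_pow] at this
  rw [← this, ← Finset.prod_mul_distrib]
  congr 1; funext i
  rw [int_scale _ _ _ (hh i), ← dl_hat]
  push_cast; rfl

lemma DD_integral (h : Fin d → ℝ) (hh : ∀ i, 0 < h i) (k j : Fin d → ℤ) :
    ∫ x, Dk h k x * Dk h j x = (∏ i, h i) * if k = j then 4 ^ d else 0 := by
  unfold Dk
  simp_rw [← Finset.prod_mul_distrib]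
  rw [integral_prodE (fun i x => dl (x / h i - k i) * dl (x / h i - j i))]
  rw [← prod_ite_eq' k j 4, ← Finset.prod_mul_distrib]
  congr 1; funext i
  rw [int_scale _ _ _ (hh i), ← dl_dl]
  push_cast; rfl

def ww (h : Fin d → ℝ) (K : Finset (Fin d → ℤ)) (e : (Fin d → ℤ) → ℝ)
    (x : EuclideanSpace ℝ (Fin d)) : ℝ := ∑ k ∈ K, e k * Tk h k x

lemma bilin_integrable {α : Type*} [MeasurableSpace α] {μ : Measure α} {ι : Type*} (K : Finset ι)
    (e f : ι → ℝ) (A B : ι → α → ℝ)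
    (hAB : ∀ k j, Integrable (fun x => A k x * B j x) μ) :
    Integrable (fun x => (∑ k ∈ K, e k * A k x) * (∑ j ∈ K, f j * B j x)) μ := by
  simp_rw [Finset.sum_mul_sum]
  refine integrable_finsetSum _ fun k _ => integrable_finsetSum _ fun j _ => ?_
  refine ((hAB k j).const_mul (e k * f j)).congr (Filter.Eventually.of_forall fun x => ?_)
  simp only; ring

lemma bilin_integral {α : Type*} [MeasurableSpace α] {μ : Measure α} {ι : Type*} (K : Finset ι)
    (e f : ι → ℝ) (A B : ι → α → ℝ)
    (hAB : ∀ k j, Integrable (fun x => A k x * B j x) μ) :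
    ∫ x, (∑ k ∈ K, e k * A k x) * (∑ j ∈ K, f j * B j x) ∂μ =
      ∑ k ∈ K, ∑ j ∈ K, e k * f j * ∫ x, A k x * B j x ∂μ := by
  have hi : ∀ k j, Integrable (fun x => e k * A k x * (f j * B j x)) μ := by
    intro k j
    refine ((hAB k j).const_mul (e k * f j)).congr (Filter.Eventually.of_forall fun x => ?_)
    simp only; ring
  simp_rw [Finset.sum_mul_sum]
  rw [integral_finsetSum _ fun k _ => integrable_finsetSum _ fun j _ => hi k j]
  refine Finset.sum_congr rfl fun k _ => ?_
  rw [integral_finsetSum _ fun j _ => hi k j]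
  refine Finset.sum_congr rfl fun j _ => ?_
  rw [← integral_const_mul]
  congr 1; funext x; ring

lemma ww_shift_integrable (h : Fin d → ℝ) (hh : ∀ i, 0 < h i) (K : Finset (Fin d → ℤ))
    (e : (Fin d → ℤ) → ℝ) (s : EuclideanSpace ℝ (Fin d)) :
    Integrable (fun x => ww h K e x * ww h K e (x + s)) :=
  bilin_integrable K e e (fun k x => Tk h k x) (fun k x => Tk h k (x + s))
    (fun k j => TT_integrable h hh k j s)

lemma ww_shift_integral (h : Fin d → ℝ) (hh : ∀ i, 0 < h i) (K : Finset (Fin d → ℤ))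
    (e : (Fin d → ℤ) → ℝ) (s : EuclideanSpace ℝ (Fin d)) :
    ∫ x, ww h K e x * ww h K e (x + s) =
      (∏ i, h i) * ∑ k ∈ K, e k * ∑ j ∈ K, (∏ i, B1 (k i - j i + s i / h i)) * e j := by
  unfold ww
  rw [bilin_integral K e e (fun k x => Tk h k x) (fun k x => Tk h k (x + s))
    (fun k j => TT_integrable h hh k j s)]
  simp_rw [TT_integral h hh, Finset.mul_sum]
  refine Finset.sum_congr rfl fun k _ => Finset.sum_congr rfl fun j _ => ?_
  ring

lemma ww_lower (h : Fin d → ℝ) (hh : ∀ i, 0 < h i) (K : Finset (Fin d → ℤ))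
    (e : (Fin d → ℤ) → ℝ) :
    (∏ i, h i) * ∑ k ∈ K, e k ^ 2 ≤ 4 ^ d * ∫ x, ww h K e x * ww h K e x := by
  set S := ∑ k ∈ K, e k ^ 2
  set H := ∏ i, h i
  set g : EuclideanSpace ℝ (Fin d) → ℝ := fun x => ∑ k ∈ K, e k * Dk h k x with hg
  have i1 : Integrable (fun x => ww h K e x * ww h K e x) := by
    simpa using ww_shift_integrable h hh K e 0
  have i2 : Integrable (fun x => g x * ww h K e x) :=
    bilin_integrable K e e (fun k x => Dk h k x) (fun k x => Tk h k x)
      (fun k j => DT_integrable h hh k j)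
  have i3 : Integrable (fun x => g x * g x) :=
    bilin_integrable K e e (fun k x => Dk h k x) (fun k x => Dk h k x)
      (fun k j => DD_integrable h hh k j)
  have v2 : ∫ x, g x * ww h K e x = H * S := by
    rw [hg]
    unfold ww
    rw [bilin_integral K e e (fun k x => Dk h k x) (fun k x => Tk h k x)
      (fun k j => DT_integrable h hh k j)]
    simp_rw [DT_integral h hh]
    rw [Finset.mul_sum]
    refine Finset.sum_congr rfl fun k hk => ?_
    rw [Finset.sum_eq_single k]
    · simp; ring
    · intro j _ hj; rw [if_neg (Ne.symm hj)]; ring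
    · intro hk'; exact absurd hk hk'
  have v3 : ∫ x, g x * g x = 4 ^ d * (H * S) := by
    rw [hg]
    rw [bilin_integral K e e (fun k x => Dk h k x) (fun k x => Dk h k x)
      (fun k j => DD_integrable h hh k j)]
    simp_rw [DD_integral h hh]
    rw [← mul_assoc, Finset.mul_sum]
    refine Finset.sum_congr rfl fun k hk => ?_
    rw [Finset.sum_eq_single k]
    · simp; ring
    · intro j _ hj; rw [if_neg (Ne.symm hj)]; ring
    · intro hk'; exact absurd hk hk'
  set c : ℝ := 4 ^ d
  have hc : 0 < c := by positivity
  have h0 : 0 ≤ ∫ x, (c * ww h K e x - g x) ^ 2 := integral_nonneg fun x => sq_nonneg _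
  have : ∫ x, (c * ww h K e x - g x) ^ 2 =
      c ^ 2 * (∫ x, ww h K e x * ww h K e x) - 2 * c * (H * S) + c * (H * S) := by
    rw [← v3, ← v2, ← integral_const_mul, ← integral_const_mul, ← integral_sub, ← integral_add]
    · congr 1; funext x; ring
    · exact (i1.const_mul _).sub (i2.const_mul _)
    · exact i3
    · exact i1.const_mul _
    · exact i2.const_mul _
  rw [this] at h0
  have : 0 ≤ c * (c * (∫ x, ww h K e x * ww h K e x) - H * S) := by nlinarith
  have := nonneg_of_mul_nonneg_right this hc
  linarith

end part2

section part3

lemma prod_abs_le_one {ι : Type*} (s : Finset ι) (a : ι → ℝ) (ha : ∀ i, |a i| ≤ 1) :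
    |∏ i ∈ s, a i| ≤ 1 := by
  rw [Finset.abs_prod]
  exact Finset.prod_le_one (fun i _ => abs_nonneg _) (fun i _ => ha i)

lemma prod_diff_le {ι : Type*} [DecidableEq ι] (s : Finset ι) (a m : ι → ℝ) (ha : ∀ i, |a i| ≤ 1)
    (hm : ∀ i, |m i| ≤ 1) (η : ℝ) (h1 : ∀ i, |a i - m i| ≤ η) :
    |∏ i ∈ s, a i - ∏ i ∈ s, m i| ≤ s.card * η := by
  induction s using Finset.induction_on with
  | empty => simp
  | insert i s hi ih =>
    rw [Finset.prod_insert hi, Finset.prod_insert hi, Finset.card_insert_of_notMem hi]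
    have e : a i * ∏ i ∈ s, a i - m i * ∏ i ∈ s, m i =
      (a i - m i) * ∏ i ∈ s, a i + m i * (∏ i ∈ s, a i - ∏ i ∈ s, m i) := by ring
    rw [e]
    refine (abs_add_le _ _).trans ?_
    rw [abs_mul, abs_mul]
    have hη : 0 ≤ η := (abs_nonneg _).trans (h1 i)
    have := mul_le_mul (h1 i) (prod_abs_le_one s a ha) (abs_nonneg _) hη
    have := mul_le_mul (hm i) ih (abs_nonneg _) zero_le_one
    push_cast
    linarith

lemma prod_diff2_le {ι : Type*} [DecidableEq ι] (s : Finset ι) (a b m : ι → ℝ)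
    (ha : ∀ i, |a i| ≤ 1) (hb : ∀ i, |b i| ≤ 1)
    (hm : ∀ i, |m i| ≤ 1) (η κ : ℝ) (h1 : ∀ i, |a i - m i| ≤ η) (h2 : ∀ i, |b i - m i| ≤ η)
    (h3 : ∀ i, |a i + b i - 2 * m i| ≤ κ) :
    |∏ i ∈ s, a i + ∏ i ∈ s, b i - 2 * ∏ i ∈ s, m i| ≤ s.card * κ + s.card ^ 2 * η ^ 2 := by
  induction s using Finset.induction_on with
  | empty => norm_num
  | insert i s hi ih =>
    rw [Finset.prod_insert hi, Finset.prod_insert hi, Finset.prod_insert hi,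
      Finset.card_insert_of_notMem hi]
    have ea := prod_diff_le s a m ha hm η h1
    have eb := prod_diff_le s b m hb hm η h2
    have em := prod_abs_le_one s m hm
    set A := ∏ i ∈ s, a i
    set B := ∏ i ∈ s, b i
    set P := ∏ i ∈ s, m i
    have e : a i * A + b i * B - 2 * (m i * P) =
      (a i + b i - 2 * m i) * P + m i * (A + B - 2 * P) + (a i - m i) * (A - P)
        + (b i - m i) * (B - P) := by ring
    rw [e]
    have hη : 0 ≤ η := (abs_nonneg _).trans (h1 i)
    have hκ : 0 ≤ κ := (abs_nonneg _).trans (h3 i)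
    have t1 := mul_le_mul (h3 i) em (abs_nonneg _) hκ
    have t2 := mul_le_mul (hm i) ih (abs_nonneg _) zero_le_one
    have t3 := mul_le_mul (h1 i) ea (abs_nonneg _) hη
    have t4 := mul_le_mul (h2 i) eb (abs_nonneg _) hη
    rw [← abs_mul] at t1 t2 t3 t4
    have := abs_add_le ((a i + b i - 2 * m i) * P + m i * (A + B - 2 * P) + (a i - m i) * (A - P))
      ((b i - m i) * (B - P))
    have := abs_add_le ((a i + b i - 2 * m i) * P + m i * (A + B - 2 * P)) ((a i - m i) * (A - P))
    have := abs_add_le ((a i + b i - 2 * m i) * P) (m i * (A + B - 2 * P))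
    push_cast
    nlinarith [sq_nonneg η]

variable {d : ℕ}

lemma Psi_eq (h : Fin d → ℝ) (hh : ∀ i, 0 < h i) (k : Fin d → ℤ) (x : EuclideanSpace ℝ (Fin d)) :
    Psi d h k x = ∏ i, B1 (x i / h i - k i) := by
  unfold Psi
  congr 1; funext i
  rw [← phi_eq]
  congr 1
  have e : x i / h i - k i = (x i - k i * h i) / h i := by
    rw [sub_div, mul_div_cancel_right₀ _ (hh i).ne']
  rw [e, abs_div, abs_of_pos (hh i), div_div]
  ring

lemma B1_abs_le (t : ℝ) : |B1 t| ≤ 1 := by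
  rw [abs_of_nonneg (B1_nonneg t)]; exact B1_le_one t

lemma Psi_nonneg (h : Fin d → ℝ) (hh : ∀ i, 0 < h i) (k : Fin d → ℤ)
    (x : EuclideanSpace ℝ (Fin d)) : 0 ≤ Psi d h k x := by
  rw [Psi_eq h hh]
  exact Finset.prod_nonneg fun i _ => B1_nonneg _

lemma Psi_le_one (h : Fin d → ℝ) (hh : ∀ i, 0 < h i) (k : Fin d → ℤ)
    (x : EuclideanSpace ℝ (Fin d)) : Psi d h k x ≤ 1 := by
  rw [Psi_eq h hh]
  exact Finset.prod_le_one (fun i _ => B1_nonneg _) (fun i _ => B1_le_one _)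

lemma continuous_Psi (h : Fin d → ℝ) (hh : ∀ i, 0 < h i) (k : Fin d → ℤ) :
    Continuous (Psi d h k) := by
  have : Psi d h k = fun x => ∏ i, B1 (x i / h i - k i) := funext (Psi_eq h hh k)
  rw [this]
  refine continuous_finsetProd _ fun i _ => continuous_B1.comp ?_
  fun_prop

lemma coord_le (x : EuclideanSpace ℝ (Fin d)) (i : Fin d) : |x i| ≤ ‖x‖ := by
  simpa using PiLp.norm_apply_le x i

lemma Psi_lip (h : Fin d → ℝ) (η : ℝ) (hη : 0 < η) (hh : ∀ i, η ≤ h i) (k : Fin d → ℤ)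
    (x s : EuclideanSpace ℝ (Fin d)) :
    |Psi d h k (x + s) - Psi d h k x| ≤ d * (8 * ‖s‖ / η) := by
  have hh' : ∀ i, 0 < h i := fun i => hη.trans_le (hh i)
  rw [Psi_eq h hh', Psi_eq h hh']
  have := prod_diff_le Finset.univ (fun i => B1 ((x + s) i / h i - k i))
    (fun i => B1 (x i / h i - k i)) (fun i => B1_abs_le _) (fun i => B1_abs_le _)
    (8 * ‖s‖ / η) ?_
  · simpa using this
  intro i
  refine (B1_lip _ _).trans ?_
  have e : (x + s) i / h i - k i - (x i / h i - k i) = s i / h i := by simp; ring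
  rw [e, abs_div, abs_of_pos (hh' i), mul_div_assoc]
  gcongr
  · exact coord_le s i
  · exact hh i

lemma Psi_diff2 (h : Fin d → ℝ) (η : ℝ) (hη : 0 < η) (hh : ∀ i, η ≤ h i) (k : Fin d → ℤ)
    (x s : EuclideanSpace ℝ (Fin d)) :
    |Psi d h k (x + s) + Psi d h k (x - s) - 2 * Psi d h k x| ≤
      (8 * d + 64 * d ^ 2) * (‖s‖ ^ 2 / η ^ 2) := by
  have hh' : ∀ i, 0 < h i := fun i => hη.trans_le (hh i)
  rw [Psi_eq h hh', Psi_eq h hh', Psi_eq h hh']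
  have hs : ∀ i, |s i / h i| ≤ ‖s‖ / η := by
    intro i
    rw [abs_div, abs_of_pos (hh' i)]
    gcongr
    · exact coord_le s i
    · exact hh i
  have := prod_diff2_le Finset.univ (fun i => B1 ((x + s) i / h i - k i))
    (fun i => B1 ((x - s) i / h i - k i))
    (fun i => B1 (x i / h i - k i)) (fun i => B1_abs_le _) (fun i => B1_abs_le _)
    (fun i => B1_abs_le _)
    (8 * (‖s‖ / η)) (8 * (‖s‖ / η) ^ 2) ?_ ?_ ?_
  · refine this.trans (le_of_eq ?_)
    simp; ring
  · intro i
    refine (B1_lip _ _).trans ?_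
    have e : (x + s) i / h i - k i - (x i / h i - k i) = s i / h i := by simp; ring
    rw [e]
    have := hs i
    linarith
  · intro i
    refine (B1_lip _ _).trans ?_
    have e : (x - s) i / h i - k i - (x i / h i - k i) = -(s i / h i) := by simp; ring
    rw [e, abs_neg]
    have := hs i
    linarith
  · intro i
    have e1 : (x + s) i / h i - k i = (x i / h i - k i) + s i / h i := by simp; ring
    have e2 : (x - s) i / h i - k i = (x i / h i - k i) - s i / h i := by simp; ring
    simp only [e1, e2]
    refine (B1_second _ _).trans ?_
    rw [← sq_abs]
    have := hs i
    gcongr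

lemma RKfun_eq (h : Fin d → ℝ) (K : Finset (Fin d → ℤ)) (e : (Fin d → ℤ) → ℝ)
    (he : ∀ k, k ∉ K → e k = 0) (x : EuclideanSpace ℝ (Fin d)) :
    RKfun d h e x = ∑ k ∈ K, Psi d h k x * e k := by
  unfold RKfun
  apply tsum_eq_sum
  intro k hk
  rw [he k hk, mul_zero]

lemma gridPt_apply (h : Fin d → ℝ) (k : Fin d → ℤ) (i : Fin d) :
    gridPt d h k i = k i * h i := by
  simp [gridPt]

/-- Kernel hypotheses. -/
structure Kern (d : ℕ) (δ : ℝ) (W : EuclideanSpace ℝ (Fin d) → ℝ) : Prop where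
  nonneg : ∀ s, 0 ≤ W s
  supp : ∀ s, δ ≤ ‖s‖ → W s = 0
  meas : AEStronglyMeasurable W
  int1 : Integrable (fun s => W s * ‖s‖)
  mom2 : ∫ s, W s * ‖s‖ ^ 2 = 2 * d
  rad : ∀ (L : EuclideanSpace ℝ (Fin d) ≃ₗᵢ[ℝ] EuclideanSpace ℝ (Fin d)) s, W (L s) = W s

lemma Kern.int_of_bound {δ : ℝ} {W : EuclideanSpace ℝ (Fin d) → ℝ} (hW : Kern d δ W)
    (f : EuclideanSpace ℝ (Fin d) → ℝ) (hf : Continuous f) (C : ℝ) (hC : ∀ s, |f s| ≤ C * ‖s‖) :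
    Integrable (fun s => W s * f s) := by
  refine (hW.int1.const_mul C).mono' (hW.meas.mul hf.aestronglyMeasurable)
    (Filter.Eventually.of_forall fun s => ?_)
  rw [norm_eq_abs, abs_mul, abs_of_nonneg (hW.nonneg s)]
  have := mul_le_mul_of_nonneg_left (hC s) (hW.nonneg s)
  linarith

lemma Kern.int2 {δ : ℝ} {W : EuclideanSpace ℝ (Fin d) → ℝ} (hW : Kern d δ W) (f : EuclideanSpace ℝ (Fin d) → ℝ)
    (hf : Continuous f) (C : ℝ) (hC0 : 0 ≤ C) (hC : ∀ s, |f s| ≤ C * ‖s‖ ^ 2) :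
    Integrable (fun s => W s * f s) := by
  refine (hW.int1.const_mul (C * δ)).mono' (hW.meas.mul hf.aestronglyMeasurable)
    (Filter.Eventually.of_forall fun s => ?_)
  rw [norm_eq_abs, abs_mul, abs_of_nonneg (hW.nonneg s)]
  by_cases hs : δ ≤ ‖s‖
  · rw [hW.supp s hs]; simp
  push Not at hs
  have h1 := mul_le_mul_of_nonneg_left (hC s) (hW.nonneg s)
  have h2 : C * ‖s‖ ^ 2 ≤ C * δ * ‖s‖ := by
    rw [mul_assoc, sq]; gcongr
  have := mul_le_mul_of_nonneg_left h2 (hW.nonneg s)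
  linarith

def Lop (W : EuclideanSpace ℝ (Fin d) → ℝ) (u : EuclideanSpace ℝ (Fin d) → ℝ)
    (x : EuclideanSpace ℝ (Fin d)) : ℝ := ∫ s, W s * (u (x + s) - u x)

section energy
variable (w : EuclideanSpace ℝ (Fin d) → ℝ)

def II (s : EuclideanSpace ℝ (Fin d)) : ℝ := ∫ x, (w (x + s) - w x) ^ 2

variable {w}

lemma II_int_aux (hw : ∀ s, Integrable (fun x => w x * w (x + s)))
    : Integrable (fun x => w x ^ 2) := by
  simpa [sq] using hw 0

lemma II_integrable (hw : ∀ s, Integrable (fun x => w x * w (x + s)))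
    (a b : EuclideanSpace ℝ (Fin d)) :
    Integrable (fun x => (w (x + a) - w (x + b)) ^ 2) := by
  have h0 := II_int_aux hw
  have h1 := h0.comp_add_right a
  have h2 := h0.comp_add_right b
  have h3 := ((hw (b - a)).comp_add_right a).const_mul 2
  refine ((h1.add h2).sub h3).congr (Filter.Eventually.of_forall fun x => ?_)
  simp only [Pi.add_apply, Pi.sub_apply]
  rw [show x + a + (b - a) = x + b by abel]
  ring

lemma II_eq (hw : ∀ s, Integrable (fun x => w x * w (x + s)))
    (s : EuclideanSpace ℝ (Fin d)) :
    II w s = 2 * (∫ x, w x * w x) - 2 * ∫ x, w x * w (x + s) := by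
  have h0 := II_int_aux hw
  have h1 := h0.comp_add_right s
  have e : ∫ x, w (x + s) ^ 2 = ∫ x, w x ^ 2 := integral_add_right_eq_self (fun x => w x ^ 2) s
  have : II w s = (∫ x, w (x + s) ^ 2) + (∫ x, w x ^ 2) - 2 * ∫ x, w x * w (x + s) := by
    unfold II
    rw [← integral_const_mul, ← integral_add h1 h0]
    have h01 : Integrable (fun x => w (x + s) ^ 2 + w x ^ 2) := h1.add h0
    rw [← integral_sub h01 ((hw s).const_mul 2)]
    congr 1; funext x; ring
  rw [this, e]
  simp_rw [sq]; ring

lemma II_nsmul (hw : ∀ s, Integrable (fun x => w x * w (x + s)))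
    (n : ℕ) (s : EuclideanSpace ℝ (Fin d)) : II w ((n:ℝ) • s) ≤ n ^ 2 * II w s := by
  have key : ∀ x, (w (x + (n:ℝ) • s) - w x) ^ 2 ≤
      n * ∑ i ∈ Finset.range n, (w (x + ((i+1 : ℕ):ℝ) • s) - w (x + (i:ℝ) • s)) ^ 2 := by
    intro x
    have h1 := Finset.sum_range_sub (fun i : ℕ => w (x + (i:ℝ) • s)) n
    simp only [Nat.cast_zero, zero_smul, add_zero] at h1
    rw [← h1]
    have := sq_sum_le_card_mul_sum_sq (s := Finset.range n)
      (f := fun i => w (x + ((i+1 : ℕ):ℝ) • s) - w (x + (i:ℝ) • s))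
    simpa using this
  have hi : ∀ i ∈ Finset.range n, Integrable
      (fun x => (w (x + ((i+1 : ℕ):ℝ) • s) - w (x + (i:ℝ) • s)) ^ 2) :=
    fun i _ => II_integrable hw _ _
  calc II w ((n:ℝ) • s) ≤ ∫ x, n * ∑ i ∈ Finset.range n,
        (w (x + ((i+1 : ℕ):ℝ) • s) - w (x + (i:ℝ) • s)) ^ 2 := by
        unfold II
        refine integral_mono_of_nonneg (Filter.Eventually.of_forall fun x => sq_nonneg _) ?_
          (Filter.Eventually.of_forall key)
        exact (integrable_finsetSum _ hi).const_mul _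
    _ = n * ∑ i ∈ Finset.range n, II w s := by
        rw [integral_const_mul, integral_finsetSum _ hi]
        congr 1
        refine Finset.sum_congr rfl fun i _ => ?_
        unfold II
        rw [← integral_add_right_eq_self (fun x => (w (x + s) - w x) ^ 2) ((i:ℝ) • s)]
        congr 1; funext x
        congr 3
        push_cast
        rw [add_smul, one_smul]; abel_nf
    _ = n ^ 2 * II w s := by simp; ring

lemma II_lower (hw : ∀ s, Integrable (fun x => w x * w (x + s)))
    (D : ℝ) (hD : 0 ≤ D) (hsupp : ∀ x, D / 2 < ‖x‖ → w x = 0)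
    (s : EuclideanSpace ℝ (Fin d)) :
    2 * (∫ x, w x * w x) * ‖s‖ ^ 2 ≤ (D + ‖s‖) ^ 2 * II w s := by
  have hI : 0 ≤ II w s := integral_nonneg fun x => sq_nonneg _
  by_cases hs : s = 0
  · subst hs; simp; positivity
  have hs' : 0 < ‖s‖ := norm_pos_iff.2 hs
  set n := ⌊D / ‖s‖⌋₊ + 1 with hn
  have h1 : D < n * ‖s‖ := by
    have := Nat.lt_floor_add_one (D / ‖s‖)
    rw [div_lt_iff₀ hs'] at this
    rw [hn]; push_cast; exact this
  have h2 : n * ‖s‖ ≤ D + ‖s‖ := by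
    have := Nat.floor_le (div_nonneg hD hs'.le)
    rw [le_div_iff₀ hs'] at this
    rw [hn]; push_cast; linarith
  have hz : ∀ x, w x * w (x + (n:ℝ) • s) = 0 := by
    intro x
    by_cases hx : D / 2 < ‖x‖
    · rw [hsupp x hx, zero_mul]
    · rw [hsupp (x + (n:ℝ) • s), mul_zero]
      have : ‖(n:ℝ) • s‖ ≤ ‖x + (n:ℝ) • s‖ + ‖x‖ := by
        have := norm_sub_le (x + (n:ℝ) • s) x
        simpa using this
      rw [norm_smul] at this
      simp only [norm_natCast] at this
      linarith
  have h3 := II_nsmul hw n s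
  rw [II_eq hw ((n:ℝ) • s)] at h3
  simp only [hz, integral_zero, mul_zero, sub_zero] at h3
  calc _ ≤ (n ^ 2 * II w s) * ‖s‖ ^ 2 := by gcongr
    _ = (n * ‖s‖) ^ 2 * II w s := by ring
    _ ≤ _ := by gcongr

end energy

lemma stab_aux {δ : ℝ} {W : EuclideanSpace ℝ (Fin d) → ℝ} (hd : 1 ≤ d) (hδ : 0 < δ) (hW : Kern d δ W)
    (h : Fin d → ℝ) (hh : ∀ i, 0 < h i) (K : Finset (Fin d → ℤ)) (e : (Fin d → ℤ) → ℝ)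
    (he : ∀ k, k ∉ K → e k = 0) (D : ℝ) (hD : 0 ≤ D)
    (hsupp : ∀ k ∈ K, ∀ x, D / 2 < ‖x‖ → Tk h k x = 0) :
    ∑ k ∈ K, e k ^ 2 ≤
      4 ^ d * (D + δ) ^ 2 * ∑ k ∈ K, e k * (-(Lop W (RKfun d h e) (gridPt d h k))) := by
  set w := ww h K e with hwdef
  set R := RKfun d h e with hR
  have hw : ∀ s, Integrable (fun x => w x * w (x + s)) := ww_shift_integrable h hh K e
  set H := ∏ i, h i with hH
  have hHpos : 0 < H := Finset.prod_pos fun i _ => hh i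
  have hA : ∀ s, ∫ x, w x * w (x + s) = H * ∑ k ∈ K, e k * R (gridPt d h k + s) := by
    intro s
    rw [hwdef, ww_shift_integral h hh]
    congr 1
    refine Finset.sum_congr rfl fun k _ => ?_
    congr 1
    rw [hR, RKfun_eq h K e he]
    refine Finset.sum_congr rfl fun j _ => ?_
    rw [Psi_eq h hh]
    congr 2
    funext i
    rw [PiLp.add_apply, gridPt_apply, add_div, mul_div_cancel_right₀ _ (hh i).ne']
    congr 1; ring
  have hA0 := hA 0
  simp only [add_zero] at hA0
  have hI : ∀ s, II w s = 2 * H * ∑ k ∈ K, -e k * (R (gridPt d h k + s) - R (gridPt d h k)) := by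
    intro s
    rw [II_eq hw, hA, hA0]
    have : ∑ k ∈ K, -e k * (R (gridPt d h k + s) - R (gridPt d h k)) =
      (∑ k ∈ K, e k * R (gridPt d h k)) - ∑ k ∈ K, e k * R (gridPt d h k + s) := by
      rw [← Finset.sum_sub_distrib]
      exact Finset.sum_congr rfl fun k _ => by ring
    rw [this]; ring
  -- Lipschitz
  obtain ⟨η, hη, hηh⟩ : ∃ η : ℝ, 0 < η ∧ ∀ i, η ≤ h i := by
    have : Nonempty (Fin d) := ⟨⟨0, hd⟩⟩
    obtain ⟨i, hi⟩ := Finite.exists_min h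
    exact ⟨h i, hh i, hi⟩
  have hRc : Continuous R := by
    have : R = fun x => ∑ k ∈ K, Psi d h k x * e k := funext (RKfun_eq h K e he)
    rw [this]
    exact continuous_finsetSum _ fun k _ => (continuous_Psi h hh k).mul continuous_const
  have hRi : ∀ x, Integrable (fun s => W s * (R (x + s) - R x)) := by
    intro x
    refine hW.int_of_bound _ (by fun_prop) (∑ k ∈ K, d * (8 / η) * |e k|) fun s => ?_
    rw [hR, RKfun_eq h K e he, RKfun_eq h K e he, ← Finset.sum_sub_distrib, Finset.sum_mul]
    refine (Finset.abs_sum_le_sum_abs _ _).trans (Finset.sum_le_sum fun k _ => ?_)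
    rw [← sub_mul, abs_mul]
    have := mul_le_mul_of_nonneg_right (Psi_lip h η hη hηh k x s) (abs_nonneg (e k))
    refine this.trans (le_of_eq ?_)
    ring
  have hWI : ∫ s, W s * II w s = 2 * H * ∑ k ∈ K, e k * (-(Lop W R (gridPt d h k))) := by
    simp_rw [hI]
    have : ∀ s, W s * (2 * H * ∑ k ∈ K, -e k * (R (gridPt d h k + s) - R (gridPt d h k))) =
        2 * H * ∑ k ∈ K, -e k * (W s * (R (gridPt d h k + s) - R (gridPt d h k))) := by
      intro s
      rw [Finset.mul_sum, Finset.mul_sum, Finset.mul_sum]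
      exact Finset.sum_congr rfl fun k _ => by ring
    simp_rw [this]
    rw [integral_const_mul, integral_finsetSum _ fun k _ => (hRi _).const_mul _]
    congr 1
    refine Finset.sum_congr rfl fun k _ => ?_
    rw [integral_const_mul]
    unfold Lop; ring
  have hWIi : Integrable (fun s => W s * II w s) := by
    simp_rw [hI]
    have : ∀ s, W s * (2 * H * ∑ k ∈ K, -e k * (R (gridPt d h k + s) - R (gridPt d h k))) =
        2 * H * ∑ k ∈ K, -e k * (W s * (R (gridPt d h k + s) - R (gridPt d h k))) := by
      intro s
      rw [Finset.mul_sum, Finset.mul_sum, Finset.mul_sum]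
      exact Finset.sum_congr rfl fun k _ => by ring
    simp_rw [this]
    exact (integrable_finsetSum _ fun k _ => (hRi _).const_mul _).const_mul _
  have hws : ∀ x, D / 2 < ‖x‖ → w x = 0 := by
    intro x hx
    rw [hwdef]; unfold ww
    exact Finset.sum_eq_zero fun k hk => by rw [hsupp k hk x hx, mul_zero]
  set A0 := ∫ x, w x * w x with hA0d
  have hlow : ∀ s, W s * (2 * A0 * ‖s‖ ^ 2) ≤ (D + δ) ^ 2 * (W s * II w s) := by
    intro s
    by_cases hs : δ ≤ ‖s‖
    · rw [hW.supp s hs]; simp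
    push Not at hs
    have h1 := II_lower hw D hD hws s
    have hI : 0 ≤ II w s := integral_nonneg fun x => sq_nonneg _
    have h2 : (D + ‖s‖) ^ 2 * II w s ≤ (D + δ) ^ 2 * II w s := by gcongr
    have := mul_le_mul_of_nonneg_left (h1.trans h2) (hW.nonneg s)
    linarith
  have hA00 : 0 ≤ A0 := integral_nonneg fun x => mul_self_nonneg _
  have hint := integral_mono (hW.int2 (fun s => 2 * A0 * ‖s‖ ^ 2) (by fun_prop) (2 * A0)
    (by positivity) (fun s => by rw [abs_of_nonneg (by positivity)])) (hWIi.const_mul _) hlow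
  rw [integral_const_mul, hWI] at hint
  have e1 : ∫ s, W s * (2 * A0 * ‖s‖ ^ 2) = 2 * A0 * (2 * d) := by
    rw [← hW.mom2, ← integral_const_mul (2 * A0)]; congr 1; funext s; ring
  rw [e1] at hint
  have hl := ww_lower h hh K e
  rw [← hwdef, ← hA0d, ← hH] at hl
  set X := ∑ k ∈ K, e k * (-(Lop W R (gridPt d h k)))
  have hd' : (1:ℝ) ≤ d := by exact_mod_cast hd
  have h3 : A0 ≤ (D + δ) ^ 2 * (H * X) := by nlinarith
  have h4 : H * ∑ k ∈ K, e k ^ 2 ≤ H * (4 ^ d * (D + δ) ^ 2 * X) := by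
    calc _ ≤ 4 ^ d * A0 := hl
      _ ≤ 4 ^ d * ((D + δ) ^ 2 * (H * X)) := by gcongr
      _ = _ := by ring
  exact le_of_mul_le_mul_left h4 hHpos

end part3

section part4

variable {d : ℕ}

def WW (d : ℕ) (ρ : ℝ → ℝ) (δ : ℝ) (s : EuclideanSpace ℝ (Fin d)) : ℝ :=
  Set.indicator (Metric.ball 0 δ) (fun s => rhoScaled d ρ δ ‖s‖) s

lemma nonlocalOp_eq (ρ : ℝ → ℝ) (δ : ℝ) (u : EuclideanSpace ℝ (Fin d) → ℝ)
    (x : EuclideanSpace ℝ (Fin d)) : nonlocalOp d ρ δ u x = Lop (WW d ρ δ) u x := by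
  unfold nonlocalOp Lop
  rw [← integral_indicator measurableSet_ball]
  congr 1
  funext s
  unfold WW
  by_cases hs : s ∈ Metric.ball (0 : EuclideanSpace ℝ (Fin d)) δ
  · rw [Set.indicator_of_mem hs, Set.indicator_of_mem hs]
  · rw [Set.indicator_of_notMem hs, Set.indicator_of_notMem hs, zero_mul]

lemma WW_scale (ρ : ℝ → ℝ) (δ : ℝ) (hδ : 0 < δ) (m : ℕ) (hm : m ≤ d + 2)
    (s : EuclideanSpace ℝ (Fin d)) :
    WW d ρ δ s * ‖s‖ ^ m = (δ ^ (d + 2 - m))⁻¹ *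
      Set.indicator (Metric.ball 0 1) (fun s : EuclideanSpace ℝ (Fin d) => ρ ‖s‖ * ‖s‖ ^ m)
        (δ⁻¹ • s) := by
  unfold WW
  have hn : ‖δ⁻¹ • s‖ = ‖s‖ / δ := by
    rw [norm_smul, norm_inv, norm_eq_abs, abs_of_pos hδ]; field_simp
  have hiff : δ⁻¹ • s ∈ Metric.ball (0 : EuclideanSpace ℝ (Fin d)) 1 ↔
      s ∈ Metric.ball (0 : EuclideanSpace ℝ (Fin d)) δ := by
    simp only [Metric.mem_ball, dist_zero_right]
    rw [hn, div_lt_one hδ]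
  by_cases hs : s ∈ Metric.ball (0 : EuclideanSpace ℝ (Fin d)) δ
  · rw [Set.indicator_of_mem hs, Set.indicator_of_mem (hiff.2 hs), hn]
    unfold rhoScaled
    have : δ ^ (d + 2) = δ ^ (d + 2 - m) * δ ^ m := by rw [← pow_add]; congr 1; omega
    rw [this, div_pow]
    field_simp
  · rw [Set.indicator_of_notMem hs, Set.indicator_of_notMem (fun h => hs (hiff.1 h))]; simp

lemma kern_WW (ρ : ℝ → ℝ)
    (hρ_nonneg : ∀ r, 0 ≤ ρ r)
    (hρ_mono : ∀ r₁ r₂, 0 ≤ r₁ → r₁ ≤ r₂ → ρ r₂ ≤ ρ r₁)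
    (hρ_mom2 : ∫ s in Metric.ball (0 : EuclideanSpace ℝ (Fin d)) 1,
        ρ ‖s‖ * ‖s‖^2 = 2 * d)
    (hρ_mom1 : IntegrableOn (fun s : EuclideanSpace ℝ (Fin d) => ρ ‖s‖ * ‖s‖)
        (Metric.ball 0 1)) (δ : ℝ) (hδ : 0 < δ) : Kern d δ (WW d ρ δ) where
  nonneg s := by
    unfold WW
    refine Set.indicator_nonneg (fun s _ => ?_) s
    unfold rhoScaled
    have := hρ_nonneg (‖s‖ / δ)
    positivity
  supp s hs := by
    unfold WW
    rw [Set.indicator_of_notMem]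
    simpa using hs
  meas := by
    have h1 : Antitone (fun r : ℝ => ρ (max r 0)) := fun a b hab =>
      hρ_mono _ _ (le_max_right _ _) (max_le_max_right 0 hab)
    have h2 : Measurable (fun s : EuclideanSpace ℝ (Fin d) => rhoScaled d ρ δ ‖s‖) := by
      have : (fun s : EuclideanSpace ℝ (Fin d) => rhoScaled d ρ δ ‖s‖) =
          fun s => (δ ^ (d + 2))⁻¹ * (fun r : ℝ => ρ (max r 0)) (‖s‖ / δ) := by
        funext s
        unfold rhoScaled
        simp only
        rw [max_eq_left (by positivity)]
      rw [this]
      exact (h1.measurable.comp (measurable_norm.div_const δ)).const_mul _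
    exact (h2.indicator measurableSet_ball).aestronglyMeasurable
  int1 := by
    have h := fun s : EuclideanSpace ℝ (Fin d) => WW_scale ρ δ hδ 1 (by omega) s
    simp only [pow_one] at h
    simp_rw [h]
    exact (((integrable_indicator_iff measurableSet_ball).2 hρ_mom1).comp_smul
      (inv_ne_zero hδ.ne')).const_mul _
  mom2 := by
    have h := fun s : EuclideanSpace ℝ (Fin d) => WW_scale ρ δ hδ 2 (by omega) s
    simp_rw [h]
    rw [integral_const_mul, Measure.integral_comp_inv_smul, integral_indicator measurableSet_ball,
      hρ_mom2]
    simp [abs_of_pos hδ]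
    field_simp
  rad L s := by
    unfold WW
    by_cases hs : s ∈ Metric.ball (0 : EuclideanSpace ℝ (Fin d)) δ
    · rw [Set.indicator_of_mem hs, Set.indicator_of_mem, L.norm_map]
      simpa using hs
    · rw [Set.indicator_of_notMem hs, Set.indicator_of_notMem]
      simpa using hs

/-! derivatives -/

def pd (l : List (Fin d)) (u : EuclideanSpace ℝ (Fin d) → ℝ) : EuclideanSpace ℝ (Fin d) → ℝ :=
  l.foldr (fun j v => pderiv1 d j v) u

lemma contDiff_pderiv (j : Fin d) (n : ℕ) (u : EuclideanSpace ℝ (Fin d) → ℝ)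
    (hu : ContDiff ℝ ((n + 1 : ℕ) : WithTop ℕ∞) u) :
    ContDiff ℝ (n : WithTop ℕ∞) (pderiv1 d j u) := by
  unfold pderiv1
  have := hu.fderiv_right (m := (n : WithTop ℕ∞)) (by push_cast; rfl)
  exact this.clm_apply contDiff_const

lemma contDiff_pd (l : List (Fin d)) (n : ℕ) (u : EuclideanSpace ℝ (Fin d) → ℝ)
    (hu : ContDiff ℝ ((n + l.length : ℕ) : WithTop ℕ∞) u) :
    ContDiff ℝ (n : WithTop ℕ∞) (pd l u) := by
  induction l generalizing n with
  | nil => simpa [pd] using hu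
  | cons a l ih =>
    exact contDiff_pderiv a n _ (ih (n + 1) (by
      rw [List.length_cons] at hu
      convert hu using 2
      omega))

lemma pderiv_comm (i j : Fin d) (u : EuclideanSpace ℝ (Fin d) → ℝ)
    (hu : ContDiff ℝ ((2 : ℕ) : WithTop ℕ∞) u) :
    pderiv1 d i (pderiv1 d j u) = pderiv1 d j (pderiv1 d i u) := by
  have hd1 : ∀ x, DifferentiableAt ℝ (fderiv ℝ u) x := fun x =>
    (hu.fderiv_right (m := 1) (by norm_num)).differentiable (by norm_num) x
  have key : ∀ (i j : Fin d) x, pderiv1 d i (pderiv1 d j u) x =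
      fderiv ℝ (fderiv ℝ u) x (EuclideanSpace.single i 1) (EuclideanSpace.single j 1) := by
    intro i j x
    unfold pderiv1
    rw [fderiv_clm_apply (hd1 x) (by fun_prop)]
    simp
  funext x
  rw [key, key]
  have := (hu.contDiffAt (x := x)).isSymmSndFDerivAt (by simp)
  exact this _ _

lemma pd_perm (u : EuclideanSpace ℝ (Fin d) → ℝ) (n : ℕ)
    (hu : ContDiff ℝ (n : WithTop ℕ∞) u) {l l' : List (Fin d)} (hl : l.Perm l')
    (hn : l.length ≤ n) : pd l u = pd l' u := by
  induction hl with
  | nil => rfl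
  | cons a h ih =>
    have := ih (by simp at hn; omega)
    show pderiv1 d a (pd _ u) = pderiv1 d a (pd _ u)
    rw [this]
  | swap a b l =>
    show pderiv1 d b (pderiv1 d a (pd l u)) = pderiv1 d a (pderiv1 d b (pd l u))
    apply pderiv_comm
    apply contDiff_pd
    simp at hn
    exact hu.of_le (by exact_mod_cast (by omega : 2 + l.length ≤ n))
  | trans h1 h2 ih1 ih2 =>
    rw [ih1 hn, ih2 (by rw [← h1.length_eq]; exact hn)]

lemma pd_append (l l' : List (Fin d)) (u : EuclideanSpace ℝ (Fin d) → ℝ) :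
    pd (l ++ l') u = pd l (pd l' u) := by
  simp [pd, List.foldr_append]

lemma pd_replicate (n : ℕ) (j : Fin d) (u : EuclideanSpace ℝ (Fin d) → ℝ) :
    pd (List.replicate n j) u = (pderiv1 d j)^[n] u := by
  induction n with
  | zero => rfl
  | succ n ih =>
    rw [Function.iterate_succ_apply', ← ih]; rfl

lemma multiDeriv_eq (α : Fin d → ℕ) (u : EuclideanSpace ℝ (Fin d) → ℝ) :
    multiDeriv d α u = pd ((List.finRange d).flatMap fun j => List.replicate (α j) j) u := by
  unfold multiDeriv
  generalize List.finRange d = L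
  induction L with
  | nil => rfl
  | cons a L ih =>
    rw [List.flatMap_cons, pd_append, pd_replicate, ← ih]; rfl

lemma pd_bound (u : EuclideanSpace ℝ (Fin d) → ℝ) (hu : ContDiff ℝ 4 u) (M : ℝ)
    (hM : ∀ β : Fin d → ℕ, (∑ j, β j) ≤ 4 → ∀ y, |multiDeriv d β u y| ≤ M)
    (l : List (Fin d)) (hl : l.length ≤ 4) (y : EuclideanSpace ℝ (Fin d)) :
    |pd l u y| ≤ M := by
  have hp : l.Perm ((List.finRange d).flatMap fun j => List.replicate (l.count j) j) := by
    rw [List.perm_iff_count]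
    intro a
    rw [List.count_flatMap]
    have : (List.count a ∘ fun j => List.replicate (List.count j l) j) =
        fun j => if j = a then List.count a l else 0 := by
      funext j
      simp only [Function.comp_apply, List.count_replicate]
      by_cases h : j = a <;> simp [h]
    rw [this, ← Fin.sum_univ_def]; simp
  have := hM (fun j => l.count j) ?_ y
  · rw [multiDeriv_eq, ← pd_perm u 4 (by exact_mod_cast hu) hp hl] at this
    exact this
  · have := Multiset.sum_count_eq_card (s := Finset.univ) (m := (l : Multiset (Fin d))) (by simp)
    simp only [Multiset.coe_count, Multiset.coe_card] at this
    omega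

end part4

section part5

variable {d : ℕ}

/-- iterated directional derivative -/
def Dm (u : EuclideanSpace ℝ (Fin d) → ℝ) : ℕ → List (Fin d) → EuclideanSpace ℝ (Fin d) →
    EuclideanSpace ℝ (Fin d) → ℝ
  | 0, l, _, x => pd l u x
  | (m+1), l, z, x => ∑ j, z j * Dm u m (j :: l) z x

def N1 (z : EuclideanSpace ℝ (Fin d)) : ℝ := ∑ j, |z j|

lemma N1_nonneg (z : EuclideanSpace ℝ (Fin d)) : 0 ≤ N1 z :=
  Finset.sum_nonneg fun _ _ => abs_nonneg _

lemma N1_neg (z : EuclideanSpace ℝ (Fin d)) : N1 (-z) = N1 z := by simp [N1]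

lemma N1_le (z : EuclideanSpace ℝ (Fin d)) : N1 z ≤ d * ‖z‖ := by
  unfold N1
  refine (Finset.sum_le_sum fun i _ => coord_le z i).trans ?_
  simp

structure Smooth4 (u : EuclideanSpace ℝ (Fin d) → ℝ) (M : ℝ) : Prop where
  cd : ContDiff ℝ ((4:ℕ) : WithTop ℕ∞) u
  bd : ∀ l : List (Fin d), l.length ≤ 4 → ∀ y, |pd l u y| ≤ M

lemma Smooth4.nonneg {u : EuclideanSpace ℝ (Fin d) → ℝ} {M : ℝ} (hu : Smooth4 u M) : 0 ≤ M :=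
  (abs_nonneg _).trans (hu.bd [] (by simp) 0)

lemma fderiv_coord (v : EuclideanSpace ℝ (Fin d) → ℝ) (x z : EuclideanSpace ℝ (Fin d)) :
    fderiv ℝ v x z = ∑ j, z j * pderiv1 d j v x := by
  have hz : z = ∑ j, z j • EuclideanSpace.single j (1:ℝ) := by
    ext i
    simp [Finset.sum_apply, Pi.single_apply]
  conv_lhs => rw [hz]
  rw [map_sum]
  refine Finset.sum_congr rfl fun j _ => ?_
  rw [map_smul]; rfl

lemma Dm_hasDeriv {u : EuclideanSpace ℝ (Fin d) → ℝ} {M : ℝ} (hu : Smooth4 u M) (m : ℕ)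
    (l : List (Fin d)) (hl : l.length + m < 4) (z y : EuclideanSpace ℝ (Fin d)) (t : ℝ) :
    HasDerivAt (fun t : ℝ => Dm u m l z (y + t • z)) (Dm u (m+1) l z (y + t • z)) t := by
  induction m generalizing l with
  | zero =>
    have h1 : ContDiff ℝ ((1:ℕ) : WithTop ℕ∞) (pd l u) :=
      contDiff_pd l 1 u (hu.cd.of_le (by exact_mod_cast (by omega : 1 + l.length ≤ 4)))
    have h2 : DifferentiableAt ℝ (pd l u) (y + t • z) :=
      h1.differentiable (by norm_num) _
    have h3 : HasDerivAt (fun t : ℝ => y + t • z) z t := by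
      simpa using ((hasDerivAt_id t).smul_const z).const_add y
    have h4 := h2.hasFDerivAt.comp_hasDerivAt t h3
    rw [fderiv_coord] at h4
    exact h4
  | succ m ih =>
    have := HasDerivAt.fun_sum (u := Finset.univ) (A := fun j (t : ℝ) => z j * Dm u m (j :: l) z (y + t • z))
      (A' := fun j => z j * Dm u (m+1) (j :: l) z (y + t • z)) (x := t)
      (fun j _ => (ih (j :: l) (by simp; omega)).const_mul (z j))
    exact this

lemma Dm_bound {u : EuclideanSpace ℝ (Fin d) → ℝ} {M : ℝ} (hu : Smooth4 u M) (m : ℕ)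
    (l : List (Fin d)) (hl : l.length + m ≤ 4) (z y : EuclideanSpace ℝ (Fin d)) :
    |Dm u m l z y| ≤ M * N1 z ^ m := by
  induction m generalizing l with
  | zero => simpa [Dm] using hu.bd l (by omega) y
  | succ m ih =>
    have : M * N1 z ^ (m+1) = ∑ j, |z j| * (M * N1 z ^ m) := by
      rw [← Finset.sum_mul]; unfold N1; ring
    rw [this]
    refine (Finset.abs_sum_le_sum_abs _ _).trans (Finset.sum_le_sum fun j _ => ?_)
    rw [abs_mul]
    exact mul_le_mul_of_nonneg_left (ih (j :: l) (by simp; omega)) (abs_nonneg _)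

lemma Dm_neg (u : EuclideanSpace ℝ (Fin d) → ℝ) (m : ℕ)
    (l : List (Fin d)) (z y : EuclideanSpace ℝ (Fin d)) :
    Dm u m l (-z) y = (-1) ^ m * Dm u m l z y := by
  induction m generalizing l with
  | zero => simp [Dm]
  | succ m ih =>
    simp only [Dm, ih, PiLp.neg_apply]
    rw [Finset.mul_sum]
    refine Finset.sum_congr rfl fun j _ => ?_
    ring

lemma step_bound (f f' : ℝ → ℝ) (hf : ∀ t, HasDerivAt f (f' t) t) (h0 : f 0 = 0) (K : ℝ)
    (hK : ∀ t ∈ Set.Icc (0:ℝ) 1, |f' t| ≤ K) : ∀ t ∈ Set.Icc (0:ℝ) 1, |f t| ≤ K := by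
  intro t ht
  have := (convex_Icc (0:ℝ) 1).norm_image_sub_le_of_norm_hasDerivWithin_le
    (f := f) (f' := f') (C := K) (fun x _ => (hf x).hasDerivWithinAt)
    hK (x := 0) (y := t) (by simp) ht
  rw [h0, sub_zero, sub_zero] at this
  have hK0 : 0 ≤ K := (abs_nonneg _).trans (hK 0 (by simp))
  simp only [norm_eq_abs, abs_of_nonneg ht.1] at this
  nlinarith [ht.2]

lemma taylor1 {u : EuclideanSpace ℝ (Fin d) → ℝ} {M : ℝ} (hu : Smooth4 u M) (y z : EuclideanSpace ℝ (Fin d)) :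
    |u (y + z) - u y| ≤ M * N1 z := by
  have h1 := step_bound (fun t => Dm u 0 [] z (y + t • z) - Dm u 0 [] z y)
    (fun t => Dm u 1 [] z (y + t • z))
    (fun t => (Dm_hasDeriv hu 0 [] (by simp) z y t).sub_const _) (by simp) (M * N1 z)
    (fun t _ => by simpa using Dm_bound hu 1 [] (by simp) z (y + t • z)) 1 (by simp)
  simpa [Dm, pd] using h1

lemma taylor2 {u : EuclideanSpace ℝ (Fin d) → ℝ} {M : ℝ} (hu : Smooth4 u M) (l : List (Fin d))
    (hl : l.length ≤ 2) (y z : EuclideanSpace ℝ (Fin d)) :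
    |pd l u (y + z) - pd l u y - Dm u 1 l z y| ≤ M * N1 z ^ 2 := by
  have h1 := step_bound (fun t => Dm u 1 l z (y + t • z) - Dm u 1 l z y)
    (fun t => Dm u 2 l z (y + t • z))
    (fun t => (Dm_hasDeriv hu 1 l (by omega) z y t).sub_const _) (by simp) (M * N1 z ^ 2)
    (fun t _ => Dm_bound hu 2 l (by omega) z (y + t • z))
  have h2 := step_bound (fun t => Dm u 0 l z (y + t • z) - Dm u 0 l z y - t * Dm u 1 l z y)
    (fun t => Dm u 1 l z (y + t • z) - Dm u 1 l z y)
    (fun t => by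
      have h := ((Dm_hasDeriv hu 0 l (by omega) z y t).sub_const (Dm u 0 l z y)).sub
        ((hasDerivAt_id t).mul_const (Dm u 1 l z y))
      exact hda_of h (fun x => by simp) (by simp))
    (by simp) (M * N1 z ^ 2) h1 1 (by simp)
  simpa [Dm] using h2

lemma taylor4 {u : EuclideanSpace ℝ (Fin d) → ℝ} {M : ℝ} (hu : Smooth4 u M)
    (y z : EuclideanSpace ℝ (Fin d)) :
    |u (y + z) - u y - Dm u 1 [] z y - Dm u 2 [] z y / 2 - Dm u 3 [] z y / 6| ≤ M * N1 z ^ 4 := by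
  have h1 := step_bound (fun t => Dm u 3 [] z (y + t • z) - Dm u 3 [] z y)
    (fun t => Dm u 4 [] z (y + t • z))
    (fun t => (Dm_hasDeriv hu 3 [] (by simp) z y t).sub_const _) (by simp) (M * N1 z ^ 4)
    (fun t _ => Dm_bound hu 4 [] (by simp) z (y + t • z))
  have h2 := step_bound (fun t => Dm u 2 [] z (y + t • z) - Dm u 2 [] z y - t * Dm u 3 [] z y)
    (fun t => Dm u 3 [] z (y + t • z) - Dm u 3 [] z y)
    (fun t => by
      have h := ((Dm_hasDeriv hu 2 [] (by simp) z y t).sub_const (Dm u 2 [] z y)).sub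
        ((hasDerivAt_id t).mul_const (Dm u 3 [] z y))
      exact hda_of h (fun x => by simp) (by simp))
    (by simp) (M * N1 z ^ 4) h1
  have h3 := step_bound (fun t => Dm u 1 [] z (y + t • z) - Dm u 1 [] z y - t * Dm u 2 [] z y
      - t ^ 2 * (Dm u 3 [] z y / 2))
    (fun t => Dm u 2 [] z (y + t • z) - Dm u 2 [] z y - t * Dm u 3 [] z y)
    (fun t => by
      have h := (((Dm_hasDeriv hu 1 [] (by simp) z y t).sub_const (Dm u 1 [] z y)).sub
        ((hasDerivAt_id t).mul_const (Dm u 2 [] z y))).sub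
        ((hasDerivAt_pow 2 t).mul_const (Dm u 3 [] z y / 2))
      exact hda_of h (fun x => by simp) (by simp; ring))
    (by simp) (M * N1 z ^ 4) h2
  have h4 := step_bound (fun t => Dm u 0 [] z (y + t • z) - Dm u 0 [] z y - t * Dm u 1 [] z y
      - t ^ 2 * (Dm u 2 [] z y / 2) - t ^ 3 * (Dm u 3 [] z y / 6))
    (fun t => Dm u 1 [] z (y + t • z) - Dm u 1 [] z y - t * Dm u 2 [] z y
      - t ^ 2 * (Dm u 3 [] z y / 2))
    (fun t => by
      have h := ((((Dm_hasDeriv hu 0 [] (by simp) z y t).sub_const (Dm u 0 [] z y)).sub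
        ((hasDerivAt_id t).mul_const (Dm u 1 [] z y))).sub
        ((hasDerivAt_pow 2 t).mul_const (Dm u 2 [] z y / 2))).sub
        ((hasDerivAt_pow 3 t).mul_const (Dm u 3 [] z y / 6))
      exact hda_of h (fun x => by simp) (by simp; ring))
    (by simp) (M * N1 z ^ 4) h3 1 (by simp)
  simpa [Dm, pd] using h4

lemma sym2 {u : EuclideanSpace ℝ (Fin d) → ℝ} {M : ℝ} (hu : Smooth4 u M) (l : List (Fin d))
    (hl : l.length ≤ 2) (y z : EuclideanSpace ℝ (Fin d)) :
    |pd l u (y + z) + pd l u (y - z) - 2 * pd l u y| ≤ 2 * (M * N1 z ^ 2) := by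
  have h1 := taylor2 hu l hl y z
  have h2 := taylor2 hu l hl y (-z)
  rw [Dm_neg, N1_neg, ← sub_eq_add_neg] at h2
  rw [abs_le] at *
  constructor <;> linarith [h1.1, h1.2, h2.1, h2.2]

lemma sym4 {u : EuclideanSpace ℝ (Fin d) → ℝ} {M : ℝ} (hu : Smooth4 u M)
    (y z : EuclideanSpace ℝ (Fin d)) :
    |u (y + z) + u (y - z) - 2 * u y - Dm u 2 [] z y| ≤ 2 * (M * N1 z ^ 4) := by
  have h1 := taylor4 hu y z
  have h2 := taylor4 hu y (-z)
  rw [Dm_neg, Dm_neg, Dm_neg, N1_neg, ← sub_eq_add_neg] at h2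
  rw [abs_le] at *
  constructor <;> linarith [h1.1, h1.2, h2.1, h2.2]

/-! nonlocal operator consistency -/

lemma Lop_sym {δ : ℝ} {W : EuclideanSpace ℝ (Fin d) → ℝ} (hW : Kern d δ W)
    (v : EuclideanSpace ℝ (Fin d) → ℝ) (hv : Continuous v) (x : EuclideanSpace ℝ (Fin d)) (C : ℝ)
    (hC : ∀ s, |v (x + s) - v x| ≤ C * ‖s‖) :
    2 * Lop W v x = ∫ s, W s * (v (x + s) + v (x - s) - 2 * v x) := by
  have h1 : Integrable (fun s => W s * (v (x + s) - v x)) :=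
    hW.int_of_bound _ (by fun_prop) C hC
  have h2 : Integrable (fun s => W s * (v (x - s) - v x)) :=
    hW.int_of_bound _ (by fun_prop) C (fun s => by
      have := hC (-s)
      rwa [norm_neg, ← sub_eq_add_neg] at this)
  have e : ∫ s, W s * (v (x - s) - v x) = Lop W v x := by
    unfold Lop
    rw [← integral_neg_eq_self]
    congr 1; funext s
    have := hW.rad (LinearIsometryEquiv.neg ℝ) s
    simp only [LinearIsometryEquiv.coe_neg] at this
    rw [this, sub_neg_eq_add]
  have : 2 * Lop W v x = (∫ s, W s * (v (x + s) - v x)) + ∫ s, W s * (v (x - s) - v x) := by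
    rw [e]; unfold Lop; ring
  rw [this, ← integral_add h1 h2]
  congr 1; funext s; ring

lemma Kern.comp_isom {δ : ℝ} {W : EuclideanSpace ℝ (Fin d) → ℝ} (hW : Kern d δ W)
    (L : EuclideanSpace ℝ (Fin d) ≃ₗᵢ[ℝ] EuclideanSpace ℝ (Fin d))
    (f : EuclideanSpace ℝ (Fin d) → ℝ) : ∫ s, W s * f (L s) = ∫ s, W s * f s := by
  have := L.measurePreserving.integral_comp L.toHomeomorph.measurableEmbedding (fun s => W s * f s)
  rw [← this]
  congr 1; funext s
  rw [hW.rad]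

lemma Kern.cross {δ : ℝ} {W : EuclideanSpace ℝ (Fin d) → ℝ} (hW : Kern d δ W) (i j : Fin d)
    (hij : i ≠ j) : ∫ s, W s * (s i * s j) = 0 := by
  set L : EuclideanSpace ℝ (Fin d) ≃ₗᵢ[ℝ] EuclideanSpace ℝ (Fin d) :=
    LinearIsometryEquiv.piLpCongrRight 2 (fun a : Fin d =>
      if a = i then LinearIsometryEquiv.neg ℝ else LinearIsometryEquiv.refl ℝ ℝ) with hL
  have := hW.comp_isom L (fun s => s i * s j)
  have e : ∀ s, L s i * L s j = - (s i * s j) := by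
    intro s
    simp [hL, LinearIsometryEquiv.piLpCongrRight_apply, Ne.symm hij]
  simp_rw [e] at this
  simp only [mul_neg, integral_neg] at this
  linarith

lemma Kern.diag {δ : ℝ} {W : EuclideanSpace ℝ (Fin d) → ℝ} (hW : Kern d δ W) (i : Fin d) :
    ∫ s, W s * (s i * s i) = 2 := by
  have hsw : ∀ j, ∫ s, W s * (s j * s j) = ∫ s, W s * (s i * s i) := by
    intro j
    set L : EuclideanSpace ℝ (Fin d) ≃ₗᵢ[ℝ] EuclideanSpace ℝ (Fin d) :=
      LinearIsometryEquiv.piLpCongrLeft 2 ℝ ℝ (Equiv.swap i j) with hL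
    have := hW.comp_isom L (fun s => s i * s i)
    have e : ∀ s, L s i = s j := by
      intro s
      simp [hL, LinearIsometryEquiv.piLpCongrLeft_apply, Equiv.piCongrLeft']
    simp_rw [e] at this
    exact this
  have hint : ∀ j : Fin d, Integrable (fun s => W s * (s j * s j)) := by
    intro j
    refine hW.int2 (fun s => s j * s j) (by fun_prop) 1 zero_le_one fun s => ?_
    rw [abs_mul, one_mul, sq]
    exact mul_le_mul (coord_le s j) (coord_le s j) (abs_nonneg _) (norm_nonneg _)
  have h2 := hW.mom2
  have e : ∀ s : EuclideanSpace ℝ (Fin d), W s * ‖s‖ ^ 2 = ∑ j, W s * (s j * s j) := by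
    intro s
    rw [EuclideanSpace.real_norm_sq_eq, Finset.mul_sum]
    exact Finset.sum_congr rfl fun j _ => by ring
  simp_rw [e] at h2
  rw [integral_finsetSum _ fun j _ => hint j] at h2
  simp_rw [hsw] at h2
  simp only [Finset.sum_const, Finset.card_univ, Fintype.card_fin, nsmul_eq_mul] at h2
  have hd : (0:ℝ) < d := by exact_mod_cast i.pos
  have : (d:ℝ) * (∫ s, W s * (s i * s i)) = d * 2 := by linarith
  exact mul_left_cancel₀ hd.ne' this

lemma Kern.int_prod {δ : ℝ} {W : EuclideanSpace ℝ (Fin d) → ℝ} (hW : Kern d δ W) (i j : Fin d) :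
    Integrable (fun s => W s * (s i * s j)) := by
  refine hW.int2 (fun s => s i * s j) (by fun_prop) 1 zero_le_one fun s => ?_
  rw [abs_mul, one_mul, sq]
  exact mul_le_mul (coord_le s i) (coord_le s j) (abs_nonneg _) (norm_nonneg _)

lemma laplacian_eq (u : EuclideanSpace ℝ (Fin d) → ℝ) (x : EuclideanSpace ℝ (Fin d)) :
    laplacian d u x = ∑ j, pd [j, j] u x := rfl

lemma Dm2_expand (u : EuclideanSpace ℝ (Fin d) → ℝ) (z y : EuclideanSpace ℝ (Fin d)) :
    Dm u 2 [] z y = ∑ j, ∑ i, pd [i, j] u y * (z i * z j) := by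
  simp only [Dm, Finset.mul_sum]
  refine Finset.sum_congr rfl fun j _ => Finset.sum_congr rfl fun i _ => by ring

lemma Dm2_int {δ : ℝ} {W : EuclideanSpace ℝ (Fin d) → ℝ} (hW : Kern d δ W)
    (u : EuclideanSpace ℝ (Fin d) → ℝ) (y : EuclideanSpace ℝ (Fin d)) :
    Integrable (fun s => W s * Dm u 2 [] s y) ∧
    ∫ s, W s * Dm u 2 [] s y = 2 * laplacian d u y := by
  have e : ∀ s, W s * Dm u 2 [] s y = ∑ j, ∑ i, pd [i, j] u y * (W s * (s i * s j)) := by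
    intro s
    rw [Dm2_expand, Finset.mul_sum]
    refine Finset.sum_congr rfl fun j _ => ?_
    rw [Finset.mul_sum]
    exact Finset.sum_congr rfl fun i _ => by ring
  simp_rw [e]
  have hi : ∀ i j : Fin d, Integrable (fun s => pd [i, j] u y * (W s * (s i * s j))) :=
    fun i j => (hW.int_prod i j).const_mul _
  refine ⟨integrable_finsetSum _ fun j _ => integrable_finsetSum _ fun i _ => hi i j, ?_⟩
  rw [integral_finsetSum _ fun j _ => integrable_finsetSum _ fun i _ => hi i j, laplacian_eq,
    Finset.mul_sum]
  refine Finset.sum_congr rfl fun j _ => ?_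
  rw [integral_finsetSum _ fun i _ => hi i j, Finset.sum_eq_single j]
  · rw [integral_const_mul, hW.diag]; ring
  · intro i _ hij
    rw [integral_const_mul, hW.cross i j hij, mul_zero]
  · simp

lemma Lop_consist {δ : ℝ} {W : EuclideanSpace ℝ (Fin d) → ℝ} (hW : Kern d δ W)
    {u : EuclideanSpace ℝ (Fin d) → ℝ} {M : ℝ} (hu : Smooth4 u M) (x : EuclideanSpace ℝ (Fin d)) :
    |Lop W u x - laplacian d u x| ≤ 2 * d ^ 5 * M * δ ^ 2 := by
  have hM := hu.nonneg
  have huc : Continuous u := hu.cd.continuous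
  have hs := Lop_sym hW u huc x (M * d) (fun s => by
    refine (taylor1 hu x s).trans ?_
    rw [mul_assoc]
    exact mul_le_mul_of_nonneg_left (N1_le s) hM)
  obtain ⟨hi, hv⟩ := Dm2_int hW u x
  have hi1 : Integrable (fun s => W s * (u (x + s) + u (x - s) - 2 * u x)) := by
    refine hW.int2 _ (by fun_prop) (2 * (M * d ^ 2)) (by positivity) fun s => ?_
    refine (sym2 hu [] (by simp) x s).trans ?_
    have : N1 s ^ 2 ≤ (d * ‖s‖) ^ 2 := pow_le_pow_left₀ (N1_nonneg s) (N1_le s) 2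
    rw [mul_assoc, mul_assoc, ← mul_pow]
    gcongr
  have e : 2 * (Lop W u x - laplacian d u x) =
      ∫ s, W s * (u (x + s) + u (x - s) - 2 * u x - Dm u 2 [] s x) := by
    rw [mul_sub, hs, ← hv, ← integral_sub hi1 hi]
    congr 1; funext s; ring
  have hb : ∀ s, ‖W s * (u (x + s) + u (x - s) - 2 * u x - Dm u 2 [] s x)‖ ≤
      2 * M * d ^ 4 * δ ^ 2 * (W s * ‖s‖ ^ 2) := by
    intro s
    rw [norm_eq_abs, abs_mul, abs_of_nonneg (hW.nonneg s)]
    by_cases hs : δ ≤ ‖s‖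
    · rw [hW.supp s hs]; simp
    push Not at hs
    have h1 : N1 s ^ 4 ≤ (d * ‖s‖) ^ 4 := pow_le_pow_left₀ (N1_nonneg s) (N1_le s) 4
    have h2 : ‖s‖ ^ 2 ≤ δ ^ 2 := by gcongr
    have h3 : 2 * (M * N1 s ^ 4) ≤ 2 * M * d ^ 4 * δ ^ 2 * ‖s‖ ^ 2 := by
      calc 2 * (M * N1 s ^ 4) ≤ 2 * (M * (d * ‖s‖) ^ 4) := by gcongr
        _ = 2 * M * d ^ 4 * ‖s‖ ^ 2 * ‖s‖ ^ 2 := by ring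
        _ ≤ _ := by gcongr
    have := mul_le_mul_of_nonneg_left ((sym4 hu x s).trans h3) (hW.nonneg s)
    linarith
  have hi2 : Integrable (fun s => W s * ‖s‖ ^ 2) :=
    hW.int2 _ (by fun_prop) 1 zero_le_one fun s => by rw [abs_of_nonneg (by positivity), one_mul]
  have := norm_integral_le_of_norm_le (hi2.const_mul (2 * M * d ^ 4 * δ ^ 2))
    (Filter.Eventually.of_forall hb)
  rw [← e, integral_const_mul, hW.mom2, norm_eq_abs, abs_mul, abs_two] at this
  linarith

end part5

section part6

section s6
variable {d : ℕ}

def Cov (h : Fin d → ℝ) (S : Fin d → Finset ℤ) (y : EuclideanSpace ℝ (Fin d)) : Prop :=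
  ∀ i, ∀ k : ℤ, |y i / h i - k| < 2 → k ∈ S i

lemma Psi_zero (h : Fin d → ℝ) (hh : ∀ i, 0 < h i) (k : Fin d → ℤ)
    (y : EuclideanSpace ℝ (Fin d)) (i : Fin d) (hi : 2 ≤ |y i / h i - k i|) :
    Psi d h k y = 0 := by
  rw [Psi_eq h hh]
  exact Finset.prod_eq_zero (Finset.mem_univ i) (B1_zero hi)

lemma RK_local (h : Fin d → ℝ) (hh : ∀ i, 0 < h i) (S : Fin d → Finset ℤ)
    (y : EuclideanSpace ℝ (Fin d)) (hS : Cov h S y) (c : (Fin d → ℤ) → ℝ) :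
    RKfun d h c y = ∑ k ∈ Fintype.piFinset S, Psi d h k y * c k := by
  unfold RKfun
  apply tsum_eq_sum
  intro k hk
  rw [Fintype.mem_piFinset, not_forall] at hk
  obtain ⟨i, hi⟩ := hk
  rw [Psi_zero h hh k y i, zero_mul]
  by_contra hc
  exact hi (hS i (k i) (not_le.mp hc))

lemma mom_tensor (h : Fin d → ℝ) (hh : ∀ i, 0 < h i) (S : Fin d → Finset ℤ)
    (y : EuclideanSpace ℝ (Fin d)) (hS : Cov h S y) (α : Fin d → ℕ) (hα : ∀ i, α i ≤ 3) :
    ∑ k ∈ Fintype.piFinset S, Psi d h k y * ∏ i, (gridPt d h k i - y i) ^ α i =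
      ∏ i, (h i ^ α i * mom (α i)) := by
  have e : ∀ i, h i ^ α i * mom (α i) =
      ∑ m ∈ S i, B1 (y i / h i - m) * ((m:ℝ) * h i - y i) ^ α i := by
    intro i
    rw [← B1_mom (y i / h i) (α i) (hα i) (S i) (hS i), Finset.mul_sum]
    refine Finset.sum_congr rfl fun m _ => ?_
    have : (m:ℝ) * h i - y i = h i * (m - y i / h i) := by
      have := (hh i).ne'
      field_simp
    rw [this, mul_pow]; ring
  rw [Finset.prod_congr rfl fun i _ => e i, Finset.prod_univ_sum]
  refine Finset.sum_congr rfl fun k _ => ?_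
  rw [Psi_eq h hh, ← Finset.prod_mul_distrib]
  refine Finset.prod_congr rfl fun i _ => ?_
  rw [gridPt_apply]

lemma mom0 (h : Fin d → ℝ) (hh : ∀ i, 0 < h i) (S : Fin d → Finset ℤ)
    (y : EuclideanSpace ℝ (Fin d)) (hS : Cov h S y) :
    ∑ k ∈ Fintype.piFinset S, Psi d h k y = 1 := by
  simpa [mom] using mom_tensor h hh S y hS (fun _ => 0) (by simp)

lemma prod_ind (f : Fin d → ℝ) (i : Fin d) : ∏ a, f a ^ (if a = i then 1 else 0) = f i := by
  simp [Finset.prod_ite_eq']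

lemma mom1 (h : Fin d → ℝ) (hh : ∀ i, 0 < h i) (S : Fin d → Finset ℤ)
    (y : EuclideanSpace ℝ (Fin d)) (hS : Cov h S y) (i : Fin d) :
    ∑ k ∈ Fintype.piFinset S, Psi d h k y * (gridPt d h k i - y i) = 0 := by
  have := mom_tensor h hh S y hS (fun a => if a = i then 1 else 0) (by intro a; split_ifs <;> simp)
  simp only [prod_ind (fun a => gridPt d h _ a - y a)] at this
  rw [this]
  exact Finset.prod_eq_zero (Finset.mem_univ i) (by simp [mom])

lemma mom2 (h : Fin d → ℝ) (hh : ∀ i, 0 < h i) (S : Fin d → Finset ℤ)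
    (y : EuclideanSpace ℝ (Fin d)) (hS : Cov h S y) (i j : Fin d) :
    ∑ k ∈ Fintype.piFinset S, Psi d h k y * ((gridPt d h k i - y i) * (gridPt d h k j - y j)) =
      if i = j then h i ^ 2 / 3 else 0 := by
  have := mom_tensor h hh S y hS
    (fun a => (if a = i then 1 else 0) + (if a = j then 1 else 0))
    (by intro a; split_ifs <;> simp)
  simp only [pow_add, Finset.prod_mul_distrib, prod_ind (fun a => gridPt d h _ a - y a),
    prod_ind] at this
  rw [this]
  split_ifs with hij
  · subst hij
    rw [Finset.prod_eq_single i]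
    · simp [mom]; ring
    · intro b _ hb; simp [hb, mom]
    · simp
  · rw [Finset.prod_eq_zero (Finset.mem_univ i), mul_zero]
    simp [mom, hij]

lemma mom3 (h : Fin d → ℝ) (hh : ∀ i, 0 < h i) (S : Fin d → Finset ℤ)
    (y : EuclideanSpace ℝ (Fin d)) (hS : Cov h S y) (i j l : Fin d) :
    ∑ k ∈ Fintype.piFinset S, Psi d h k y * ((gridPt d h k i - y i) * (gridPt d h k j - y j) *
      (gridPt d h k l - y l)) = 0 := by
  have := mom_tensor h hh S y hS
    (fun a => (if a = i then 1 else 0) + (if a = j then 1 else 0) + (if a = l then 1 else 0))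
    (by intro a; split_ifs <;> simp)
  simp only [pow_add, Finset.prod_mul_distrib, prod_ind (fun a => gridPt d h _ a - y a),
    prod_ind] at this
  rw [this]
  by_cases hij : i = j
  · subst hij
    rw [Finset.prod_eq_zero (Finset.mem_univ l), mul_zero]
    by_cases hl : l = i <;> simp [hl, mom]
  · by_cases hl : l = i
    · subst hl
      rw [Finset.prod_eq_zero (Finset.mem_univ j), mul_zero]
      simp [Ne.symm hij, mom]
    · rw [Finset.prod_eq_zero (Finset.mem_univ i), mul_zero]
      simp [hij, Ne.symm hl, mom]

lemma exists_cov (h : Fin d → ℝ) (y : EuclideanSpace ℝ (Fin d)) : ∃ S, Cov h S y := by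
  refine ⟨fun i => Finset.Icc (⌊y i / h i⌋ - 3) (⌊y i / h i⌋ + 3), fun i k hk => ?_⟩
  rw [abs_lt] at hk
  have h1 := Int.floor_le (y i / h i)
  have h2 := Int.lt_floor_add_one (y i / h i)
  rw [Finset.mem_Icc]
  constructor
  · have : ((⌊y i / h i⌋ - 3 : ℤ) : ℝ) < k := by push_cast; linarith
    exact le_of_lt (by exact_mod_cast this)
  · have : (k : ℝ) < ((⌊y i / h i⌋ + 3 : ℤ) : ℝ) := by push_cast; linarith
    exact le_of_lt (by exact_mod_cast this)

lemma N1_grid (h : Fin d → ℝ) (hh : ∀ i, 0 < h i) (H : ℝ) (hH : ∀ i, h i ≤ H) (k : Fin d → ℤ)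
    (y : EuclideanSpace ℝ (Fin d)) (A : ℝ) (hk : ∀ i, |y i / h i - k i| ≤ A) :
    N1 (gridPt d h k - y) ≤ A * d * H := by
  unfold N1
  have : ∀ i ∈ (Finset.univ : Finset (Fin d)), |(gridPt d h k - y) i| ≤ A * H := by
    intro i _
    have e : (gridPt d h k - y) i = -(h i * (y i / h i - k i)) := by
      have := (hh i).ne'
      simp only [PiLp.sub_apply, gridPt_apply]; field_simp; ring
    rw [e, abs_neg, abs_mul, abs_of_pos (hh i), mul_comm A]
    exact mul_le_mul (hH i) (hk i) (abs_nonneg _) ((hh i).le.trans (hH i))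
  refine (Finset.sum_le_sum this).trans ?_
  simp; nlinarith

/-- Dual expansion of the quasi-interpolant. -/
lemma Q_expand (h : Fin d → ℝ) (hh : ∀ i, 0 < h i) (H : ℝ) (hH : ∀ i, h i ≤ H)
    {u : EuclideanSpace ℝ (Fin d) → ℝ} {M : ℝ} (hu : Smooth4 u M)
    (y : EuclideanSpace ℝ (Fin d)) :
    |RKfun d h (fun k => u (gridPt d h k)) y - u y - ∑ i, h i ^ 2 / 6 * pd [i, i] u y| ≤
      M * (2 * d * H) ^ 4 := by
  obtain ⟨S, hS⟩ := exists_cov h y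
  have hM := hu.nonneg
  rw [RK_local h hh S y hS]
  have m0 := mom0 h hh S y hS
  have e1 : ∑ k ∈ Fintype.piFinset S, Psi d h k y * Dm u 1 [] (gridPt d h k - y) y = 0 := by
    simp only [Dm, Finset.mul_sum]
    rw [Finset.sum_comm]
    refine Finset.sum_eq_zero fun i _ => ?_
    have := mom1 h hh S y hS i
    rw [← mul_eq_zero_of_left this (pd [i] u y), Finset.sum_mul]
    refine Finset.sum_congr rfl fun k _ => by simp only [PiLp.sub_apply]; ring
  have e2 : ∑ k ∈ Fintype.piFinset S, Psi d h k y * Dm u 2 [] (gridPt d h k - y) y =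
      ∑ i, h i ^ 2 / 3 * pd [i, i] u y := by
    simp only [Dm2_expand, Finset.mul_sum]
    rw [Finset.sum_comm]
    refine Finset.sum_congr rfl fun j _ => ?_
    rw [Finset.sum_comm]
    have : ∀ i, ∑ k ∈ Fintype.piFinset S, Psi d h k y * (pd [i, j] u y *
        ((gridPt d h k - y) i * (gridPt d h k - y) j)) =
        (if i = j then h i ^ 2 / 3 else 0) * pd [i, j] u y := by
      intro i
      rw [← mom2 h hh S y hS i j, Finset.sum_mul]
      refine Finset.sum_congr rfl fun k _ => by simp only [PiLp.sub_apply]; ring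
    simp only [this]; simp
  have e3 : ∑ k ∈ Fintype.piFinset S, Psi d h k y * Dm u 3 [] (gridPt d h k - y) y = 0 := by
    simp only [Dm, Finset.mul_sum]
    rw [Finset.sum_comm]
    refine Finset.sum_eq_zero fun i _ => ?_
    rw [Finset.sum_comm]
    refine Finset.sum_eq_zero fun j _ => ?_
    rw [Finset.sum_comm]
    refine Finset.sum_eq_zero fun l _ => ?_
    have := mom3 h hh S y hS i j l
    rw [← mul_eq_zero_of_left this (pd [l, j, i] u y), Finset.sum_mul]
    refine Finset.sum_congr rfl fun k _ => by simp only [PiLp.sub_apply]; ring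
  have e : ∑ k ∈ Fintype.piFinset S, Psi d h k y * u (gridPt d h k) - u y -
      ∑ i, h i ^ 2 / 6 * pd [i, i] u y =
      ∑ k ∈ Fintype.piFinset S, Psi d h k y * (u (y + (gridPt d h k - y)) - u y -
        Dm u 1 [] (gridPt d h k - y) y - Dm u 2 [] (gridPt d h k - y) y / 2
        - Dm u 3 [] (gridPt d h k - y) y / 6) := by
    have e4 : ∑ i, h i ^ 2 / 6 * pd [i, i] u y = (∑ i, h i ^ 2 / 3 * pd [i, i] u y) / 2 := by
      rw [Finset.sum_div]
      refine Finset.sum_congr rfl fun k _ => by ring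
    rw [e4, ← e2]
    have e5 : u y = ∑ k ∈ Fintype.piFinset S, Psi d h k y * u y := by
      rw [← Finset.sum_mul, m0, one_mul]
    simp only [mul_sub, Finset.sum_sub_distrib, mul_div_assoc', ← Finset.sum_div, e1, e3, ← e5,
      add_sub_cancel]
    ring
  rw [e]
  refine (Finset.abs_sum_le_sum_abs _ _).trans ?_
  calc _ ≤ ∑ k ∈ Fintype.piFinset S, Psi d h k y * (M * (2 * d * H) ^ 4) := by
        refine Finset.sum_le_sum fun k _ => ?_
        rw [abs_mul, abs_of_nonneg (Psi_nonneg h hh k y)]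
        by_cases hk : ∀ i, |y i / h i - k i| ≤ 2
        · refine mul_le_mul_of_nonneg_left ?_ (Psi_nonneg h hh k y)
          refine (taylor4 hu y _).trans (mul_le_mul_of_nonneg_left ?_ hM)
          exact pow_le_pow_left₀ (N1_nonneg _) (N1_grid h hh H hH k y 2 hk) 4
        · push Not at hk
          obtain ⟨i, hi⟩ := hk
          rw [Psi_zero h hh k y i hi.le]; simp
    _ = _ := by rw [← Finset.sum_mul, m0, one_mul]

end s6

end part6

section part7

section s7
variable {d : ℕ}

lemma gridPt_div (h : Fin d → ℝ) (hh : ∀ i, 0 < h i) (k : Fin d → ℤ) (i : Fin d) :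
    gridPt d h k i / h i = k i := by
  rw [gridPt_apply, mul_div_assoc, div_self (hh i).ne', mul_one]

lemma Psi_reflect (h : Fin d → ℝ) (hh : ∀ i, 0 < h i) (k k0 : Fin d → ℤ)
    (s : EuclideanSpace ℝ (Fin d)) :
    Psi d h (2 • k0 - k) (gridPt d h k0 + s) = Psi d h k (gridPt d h k0 - s) := by
  rw [Psi_eq h hh, Psi_eq h hh]
  refine Finset.prod_congr rfl fun i _ => ?_
  rw [← B1_neg]
  congr 1
  simp only [PiLp.add_apply, PiLp.sub_apply, add_div, sub_div, gridPt_div h hh]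
  simp; ring

lemma gridPt_reflect (h : Fin d → ℝ) (k k0 : Fin d → ℤ) :
    gridPt d h (2 • k0 - k) = gridPt d h k0 - (gridPt d h k - gridPt d h k0) := by
  ext i
  simp [gridPt_apply]; ring

lemma cov_near (h : Fin d → ℝ) (hh : ∀ i, 0 < h i) (k0 : Fin d → ℤ)
    (s : EuclideanSpace ℝ (Fin d)) (hs : ∀ i, ‖s‖ ≤ h i) :
    Cov h (fun i => Finset.Icc (k0 i - 3) (k0 i + 3)) (gridPt d h k0 + s) := by
  intro i k hk
  rw [PiLp.add_apply, add_div, gridPt_div h hh] at hk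
  have h1 : |s i / h i| ≤ 1 := by
    rw [abs_div, abs_of_pos (hh i), div_le_one (hh i)]
    exact (coord_le s i).trans (hs i)
  rw [abs_le] at h1
  rw [abs_lt] at hk
  rw [Finset.mem_Icc]
  constructor
  · have : ((k0 i - 3 : ℤ) : ℝ) < k := by push_cast; linarith
    exact le_of_lt (by exact_mod_cast this)
  · have : (k : ℝ) < ((k0 i + 3 : ℤ) : ℝ) := by push_cast; linarith
    exact le_of_lt (by exact_mod_cast this)

lemma mom2_shift (h : Fin d → ℝ) (hh : ∀ i, 0 < h i) (S : Fin d → Finset ℤ)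
    (x s : EuclideanSpace ℝ (Fin d)) (hS : Cov h S (x + s)) (i j : Fin d) :
    ∑ k ∈ Fintype.piFinset S, Psi d h k (x + s) * ((gridPt d h k - x) i * (gridPt d h k - x) j) =
      (if i = j then h i ^ 2 / 3 else 0) + s i * s j := by
  have m0 := mom0 h hh S _ hS
  have m1 := mom1 h hh S _ hS i
  have m1' := mom1 h hh S _ hS j
  rw [← mom2 h hh S _ hS i j]
  have : ∀ k, Psi d h k (x + s) * ((gridPt d h k - x) i * (gridPt d h k - x) j) =
     Psi d h k (x + s) * ((gridPt d h k i - (x + s) i) * (gridPt d h k j - (x + s) j)) +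
     (s j * (Psi d h k (x + s) * (gridPt d h k i - (x + s) i)) +
     s i * (Psi d h k (x + s) * (gridPt d h k j - (x + s) j)) + s i * s j * Psi d h k (x + s)) := by
    intro k
    simp only [PiLp.sub_apply, PiLp.add_apply]; ring
  simp only [this, Finset.sum_add_distrib, ← Finset.mul_sum, m0, m1, m1']
  ring

lemma Q_near (h : Fin d → ℝ) (η : ℝ) (hη : 0 < η) (hηh : ∀ i, η ≤ h i) (H : ℝ) (hH : ∀ i, h i ≤ H)
    {u : EuclideanSpace ℝ (Fin d) → ℝ} {M : ℝ} (hu : Smooth4 u M)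
    (k0 : Fin d → ℤ) (s : EuclideanSpace ℝ (Fin d)) (hs : ‖s‖ ≤ η) (Q : EuclideanSpace ℝ (Fin d) → ℝ)
    (hQ : Q = RKfun d h (fun k => u (gridPt d h k))) (x : EuclideanSpace ℝ (Fin d))
    (hx : x = gridPt d h k0) :
    |Q (x + s) + Q (x - s) - 2 * Q x - (u (x + s) + u (x - s) - 2 * u x)| ≤
      7 ^ d * ((8 * d + 64 * d ^ 2) * (‖s‖ ^ 2 / η ^ 2) * (M * (3 * d * H) ^ 4)) +
        2 * (M * N1 s ^ 4) := by
  have hh : ∀ i, 0 < h i := fun i => hη.trans_le (hηh i)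
  have hM := hu.nonneg
  set S : Fin d → Finset ℤ := fun i => Finset.Icc (k0 i - 3) (k0 i + 3) with hSdef
  set K := Fintype.piFinset S with hK
  have c1 : Cov h S (x + s) := by
    rw [hx]; exact cov_near h hh k0 s (fun i => hs.trans (hηh i))
  have c2 : Cov h S (x + -s) := by
    rw [hx]; exact cov_near h hh k0 (-s) (fun i => by rw [norm_neg]; exact hs.trans (hηh i))
  have c0 : Cov h S (x + 0) := by
    rw [hx]; exact cov_near h hh k0 0 (fun i => by rw [norm_zero]; exact (hh i).le)
  set w : (Fin d → ℤ) → ℝ := fun k => Psi d h k (x + s) + Psi d h k (x + -s) - 2 * Psi d h k (x + 0)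
    with hw
  have hcard : (K.card : ℝ) = 7 ^ d := by
    have : ∀ i, (S i).card = 7 := by intro i; simp [hSdef]; omega
    rw [hK, Fintype.card_piFinset]
    simp [this]
  have e1 : Q (x + s) + Q (x - s) - 2 * Q x = ∑ k ∈ K, w k * u (gridPt d h k) := by
    have : Q x = Q (x + 0) := by rw [add_zero]
    rw [this, sub_eq_add_neg x s, hQ, RK_local h hh S _ c1, RK_local h hh S _ c2,
      RK_local h hh S _ c0, Finset.mul_sum, ← Finset.sum_add_distrib, ← Finset.sum_sub_distrib]
    refine Finset.sum_congr rfl fun k _ => by simp only [hw]; ring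
  have hwr : ∀ k, w (2 • k0 - k) = w k := by
    intro k
    simp only [hw, hx, Psi_reflect h hh]
    simp only [sub_neg_eq_add, sub_zero, add_zero, ← sub_eq_add_neg]
    ring
  have e2 : ∑ k ∈ K, w k * u (gridPt d h k) =
      ∑ k ∈ K, w k * u (x - (gridPt d h k - x)) := by
    refine Finset.sum_equiv (Equiv.subLeft (2 • k0)) ?_ ?_
    · intro k
      simp only [hK, Fintype.mem_piFinset, hSdef, Finset.mem_Icc, Equiv.subLeft_apply,
        Pi.sub_apply, Pi.smul_apply]
      refine forall_congr' fun i => ?_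
      simp only [nsmul_eq_mul]; push_cast
      omega
    · intro k _
      rw [Equiv.subLeft_apply, hwr, gridPt_reflect, ← hx]
      simp
  have e3 : ∑ k ∈ K, w k = 0 := by
    simp only [hw, Finset.sum_sub_distrib, Finset.sum_add_distrib, ← Finset.mul_sum]
    rw [mom0 h hh S _ c0, mom0 h hh S _ c1, mom0 h hh S _ c2]; norm_num
  have e4 : ∑ k ∈ K, w k * Dm u 2 [] (gridPt d h k - x) x = 2 * Dm u 2 [] s x := by
    simp only [Dm2_expand, Finset.mul_sum]
    rw [Finset.sum_comm]
    refine Finset.sum_congr rfl fun j _ => ?_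
    rw [Finset.sum_comm]
    refine Finset.sum_congr rfl fun i _ => ?_
    have m1 := mom2_shift h hh S _ _ c1 i j
    have m2 := mom2_shift h hh S _ _ c2 i j
    have m3 := mom2_shift h hh S _ _ c0 i j
    have : ∀ k, w k * (pd [i, j] u x * ((gridPt d h k - x) i * (gridPt d h k - x) j)) =
      pd [i, j] u x * (Psi d h k (x + s) * ((gridPt d h k - x) i * (gridPt d h k - x) j) +
        Psi d h k (x + -s) * ((gridPt d h k - x) i * (gridPt d h k - x) j) -
        2 * (Psi d h k (x + 0) * ((gridPt d h k - x) i * (gridPt d h k - x) j))) := by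
      intro k; simp only [hw]; ring
    simp only [this, ← Finset.mul_sum, Finset.sum_sub_distrib, Finset.sum_add_distrib]
    rw [hK, m1, m2, m3]
    simp only [PiLp.neg_apply, PiLp.zero_apply]
    ring
  set R : (Fin d → ℤ) → ℝ := fun k => u (x + (gridPt d h k - x)) + u (x - (gridPt d h k - x)) -
    2 * u x - Dm u 2 [] (gridPt d h k - x) x with hR
  have e5 : 2 * ∑ k ∈ K, w k * u (gridPt d h k) = 2 * Dm u 2 [] s x + ∑ k ∈ K, w k * R k := by
    have : ∑ k ∈ K, w k * R k = ∑ k ∈ K, w k * u (gridPt d h k) +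
      ∑ k ∈ K, w k * u (x - (gridPt d h k - x)) - 2 * u x * ∑ k ∈ K, w k -
      ∑ k ∈ K, w k * Dm u 2 [] (gridPt d h k - x) x := by
      rw [Finset.mul_sum, ← Finset.sum_add_distrib, ← Finset.sum_sub_distrib,
        ← Finset.sum_sub_distrib]
      refine Finset.sum_congr rfl fun k _ => ?_
      simp only [hR, add_sub_cancel]; ring
    rw [this, e3, e4, ← e2]; ring
  have hRb : |∑ k ∈ K, w k * R k| ≤
      7 ^ d * ((8 * d + 64 * d ^ 2) * (‖s‖ ^ 2 / η ^ 2) * (2 * (M * (3 * d * H) ^ 4))) := by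
    refine (Finset.abs_sum_le_sum_abs _ _).trans ?_
    rw [← hcard, ← nsmul_eq_mul]
    refine Finset.sum_le_card_nsmul _ _ _ fun k hk => ?_
    rw [abs_mul]
    refine mul_le_mul ?_ ?_ (abs_nonneg _) (by positivity)
    · have := Psi_diff2 h η hη hηh k x s
      simpa only [hw, add_zero, ← sub_eq_add_neg] using this
    · refine (sym4 hu x _).trans ?_
      refine mul_le_mul_of_nonneg_left (mul_le_mul_of_nonneg_left ?_ hM) (by norm_num)
      refine pow_le_pow_left₀ (N1_nonneg _) (N1_grid h hh H hH k x 3 fun i => ?_) 4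
      rw [hK, Fintype.mem_piFinset] at hk
      have := hk i
      simp only [hSdef, Finset.mem_Icc] at this
      rw [hx, gridPt_div h hh, abs_le]
      constructor
      · have : ((k i : ℤ) : ℝ) ≤ ((k0 i + 3 : ℤ) : ℝ) := by exact_mod_cast this.2
        push_cast at this; linarith
      · have : ((k0 i - 3 : ℤ) : ℝ) ≤ ((k i : ℤ) : ℝ) := by exact_mod_cast this.1
        push_cast at this; linarith
  have h4 := sym4 hu x s
  rw [e1]
  rw [abs_le] at *
  constructor <;> linarith [h4.1, h4.2, hRb.1, hRb.2]

lemma Q_far (h : Fin d → ℝ) (η : ℝ) (hη : 0 < η) (hηh : ∀ i, η ≤ h i) (H : ℝ) (hH : ∀ i, h i ≤ H)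
    {u : EuclideanSpace ℝ (Fin d) → ℝ} {M : ℝ} (hu : Smooth4 u M)
    (x s : EuclideanSpace ℝ (Fin d)) (Q : EuclideanSpace ℝ (Fin d) → ℝ)
    (hQ : Q = RKfun d h (fun k => u (gridPt d h k))) :
    |Q (x + s) + Q (x - s) - 2 * Q x - (u (x + s) + u (x - s) - 2 * u x)| ≤
      d * (H ^ 2 / 6 * (2 * (M * N1 s ^ 2))) + 4 * (M * (2 * d * H) ^ 4) := by
  have hh : ∀ i, 0 < h i := fun i => hη.trans_le (hηh i)
  have a1 := Q_expand h hh H hH hu (x + s)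
  have a2 := Q_expand h hh H hH hu (x - s)
  have a3 := Q_expand h hh H hH hu x
  rw [← hQ] at a1 a2 a3
  have b : |∑ i, h i ^ 2 / 6 * pd [i, i] u (x + s) + ∑ i, h i ^ 2 / 6 * pd [i, i] u (x - s) -
      2 * ∑ i, h i ^ 2 / 6 * pd [i, i] u x| ≤ d * (H ^ 2 / 6 * (2 * (M * N1 s ^ 2))) := by
    rw [Finset.mul_sum, ← Finset.sum_add_distrib, ← Finset.sum_sub_distrib]
    refine (Finset.abs_sum_le_sum_abs _ _).trans ?_
    have := Finset.sum_le_card_nsmul (Finset.univ : Finset (Fin d))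
      (fun i => |h i ^ 2 / 6 * pd [i, i] u (x + s) + h i ^ 2 / 6 * pd [i, i] u (x - s) -
        2 * (h i ^ 2 / 6 * pd [i, i] u x)|) (H ^ 2 / 6 * (2 * (M * N1 s ^ 2))) (fun i _ => by
        have e : h i ^ 2 / 6 * pd [i, i] u (x + s) + h i ^ 2 / 6 * pd [i, i] u (x - s) -
          2 * (h i ^ 2 / 6 * pd [i, i] u x) = h i ^ 2 / 6 * (pd [i, i] u (x + s) +
            pd [i, i] u (x - s) - 2 * pd [i, i] u x) := by ring
        rw [e, abs_mul, abs_of_nonneg (by positivity)]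
        refine mul_le_mul ?_ (sym2 hu [i, i] (by simp) x s) (abs_nonneg _) (by positivity)
        have := pow_le_pow_left₀ (hh i).le (hH i) 2
        linarith)
    simpa using this
  rw [abs_le] at *
  constructor <;> linarith [a1.1, a1.2, a2.1, a2.2, a3.1, a3.2, b.1, b.2]

def C1 (d : ℕ) (a M : ℝ) : ℝ :=
  M * (7 ^ d * (8 * d + 64 * d ^ 2) * (81 * d ^ 4) / a ^ 2 + 2 * d ^ 4 + d ^ 3 + 64 * d ^ 4 / a ^ 2)

lemma C1_nonneg (d : ℕ) (a M : ℝ) (hM : 0 ≤ M) : 0 ≤ C1 d a M := by unfold C1; positivity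

lemma Q_second (h : Fin d → ℝ) (H a : ℝ) (ha : 0 < a) (ha1 : a ≤ 1) (hH0 : 0 < H)
    (hηh : ∀ i, a * H ≤ h i) (hH : ∀ i, h i ≤ H)
    {u : EuclideanSpace ℝ (Fin d) → ℝ} {M : ℝ} (hu : Smooth4 u M)
    (k0 : Fin d → ℤ) (s : EuclideanSpace ℝ (Fin d)) (Q : EuclideanSpace ℝ (Fin d) → ℝ)
    (hQ : Q = RKfun d h (fun k => u (gridPt d h k))) (x : EuclideanSpace ℝ (Fin d))
    (hx : x = gridPt d h k0) :
    |Q (x + s) + Q (x - s) - 2 * Q x - (u (x + s) + u (x - s) - 2 * u x)| ≤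
      C1 d a M * H ^ 2 * ‖s‖ ^ 2 := by
  have hM := hu.nonneg
  have hη : 0 < a * H := by positivity
  have hN := N1_le s
  have hN0 := N1_nonneg s
  have hs0 := norm_nonneg s
  set A := 7 ^ d * (8 * (d:ℝ) + 64 * d ^ 2) * (81 * d ^ 4) / a ^ 2 with hA
  have hA0 : 0 ≤ A := by positivity
  set B := 64 * (d:ℝ) ^ 4 / a ^ 2 with hB
  have hB0 : 0 ≤ B := by positivity
  have hC : C1 d a M = M * (A + 2 * d ^ 4 + d ^ 3 + B) := rfl
  rw [hC]
  rcases le_total ‖s‖ (a * H) with hs | hs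
  · refine (Q_near h (a * H) hη hηh H hH hu k0 s hs Q hQ x hx).trans ?_
    have e : 7 ^ d * ((8 * d + 64 * d ^ 2) * (‖s‖ ^ 2 / (a * H) ^ 2) * (M * (3 * d * H) ^ 4)) =
        M * A * H ^ 2 * ‖s‖ ^ 2 := by
      rw [hA]; field_simp; ring
    rw [e]
    have h1 : N1 s ^ 4 ≤ d ^ 4 * (H ^ 2 * ‖s‖ ^ 2) := by
      have h2 : ‖s‖ ≤ H := hs.trans (by nlinarith)
      calc N1 s ^ 4 ≤ (d * ‖s‖) ^ 4 := pow_le_pow_left₀ hN0 hN 4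
        _ = d ^ 4 * (‖s‖ ^ 2 * ‖s‖ ^ 2) := by ring
        _ ≤ _ := by gcongr
    have h2 := mul_le_mul_of_nonneg_left h1 hM
    have h3 : 0 ≤ M * (d ^ 3 + B) * H ^ 2 * ‖s‖ ^ 2 := by positivity
    nlinarith
  · refine (Q_far h (a * H) hη hηh H hH hu x s Q hQ).trans ?_
    have h1 : N1 s ^ 2 ≤ d ^ 2 * ‖s‖ ^ 2 := by
      rw [← mul_pow]; exact pow_le_pow_left₀ hN0 hN 2
    have h2 : d * (H ^ 2 / 6 * (2 * (M * N1 s ^ 2))) ≤ d * (H ^ 2 / 6 * (2 * (M * (d ^ 2 * ‖s‖ ^ 2)))) := by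
      gcongr
    have h3 : 4 * (M * (2 * d * H) ^ 4) ≤ M * B * H ^ 2 * ‖s‖ ^ 2 := by
      have h4 : (a * H) ^ 2 ≤ ‖s‖ ^ 2 := pow_le_pow_left₀ hη.le hs 2
      calc 4 * (M * (2 * d * H) ^ 4) = M * B * H ^ 2 * (a * H) ^ 2 := by
            rw [hB]; field_simp; ring
        _ ≤ _ := by gcongr
    have h5 : 0 ≤ M * (A + 2 * d ^ 4) * H ^ 2 * ‖s‖ ^ 2 := by positivity
    have h6 : 0 ≤ M * d ^ 3 * H ^ 2 * ‖s‖ ^ 2 := by positivity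
    nlinarith

end s7

end part7

section part8

section s8
variable {d : ℕ}

lemma RK_cont (h : Fin d → ℝ) (hh : ∀ i, 0 < h i) (K : Finset (Fin d → ℤ)) (e : (Fin d → ℤ) → ℝ)
    (he : ∀ k, k ∉ K → e k = 0) : Continuous (RKfun d h e) := by
  rw [funext (RKfun_eq h K e he)]
  exact continuous_finsetSum _ fun k _ => (continuous_Psi h hh k).mul continuous_const

lemma RK_lip (h : Fin d → ℝ) (η : ℝ) (hη : 0 < η) (hh : ∀ i, η ≤ h i) (K : Finset (Fin d → ℤ))
    (e : (Fin d → ℤ) → ℝ) (he : ∀ k, k ∉ K → e k = 0) :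
    ∃ C, ∀ x s, |RKfun d h e (x + s) - RKfun d h e x| ≤ C * ‖s‖ := by
  refine ⟨∑ k ∈ K, d * (8 / η) * |e k|, fun x s => ?_⟩
  rw [RKfun_eq h K e he, RKfun_eq h K e he, ← Finset.sum_sub_distrib, Finset.sum_mul]
  refine (Finset.abs_sum_le_sum_abs _ _).trans (Finset.sum_le_sum fun k _ => ?_)
  rw [← sub_mul, abs_mul]
  have := mul_le_mul_of_nonneg_right (Psi_lip h η hη hh k x s) (abs_nonneg (e k))
  refine this.trans (le_of_eq ?_)
  ring

lemma RK_sub (h : Fin d → ℝ) (K : Finset (Fin d → ℤ)) (e f : (Fin d → ℤ) → ℝ)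
    (he : ∀ k, k ∉ K → e k = 0) (hf : ∀ k, k ∉ K → f k = 0) (x : EuclideanSpace ℝ (Fin d)) :
    RKfun d h (fun k => e k - f k) x = RKfun d h e x - RKfun d h f x := by
  rw [RKfun_eq h K e he, RKfun_eq h K f hf, RKfun_eq h K _ (fun k hk => by
    rw [he k hk, hf k hk, sub_zero]), ← Finset.sum_sub_distrib]
  refine Finset.sum_congr rfl fun k _ => by ring

lemma Lop_sub {δ : ℝ} {W : EuclideanSpace ℝ (Fin d) → ℝ} (hW : Kern d δ W)
    (v w : EuclideanSpace ℝ (Fin d) → ℝ) (hv : Continuous v) (hw : Continuous w)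
    (x : EuclideanSpace ℝ (Fin d)) (C C' : ℝ)
    (hC : ∀ s, |v (x + s) - v x| ≤ C * ‖s‖) (hC' : ∀ s, |w (x + s) - w x| ≤ C' * ‖s‖) :
    Lop W (fun y => v y - w y) x = Lop W v x - Lop W w x := by
  unfold Lop
  rw [← integral_sub (hW.int_of_bound _ (by fun_prop) C hC) (hW.int_of_bound _ (by fun_prop) C' hC')]
  congr 1; funext s; ring

lemma u_lip {u : EuclideanSpace ℝ (Fin d) → ℝ} {M : ℝ} (hu : Smooth4 u M)
    (x s : EuclideanSpace ℝ (Fin d)) : |u (x + s) - u x| ≤ M * d * ‖s‖ := by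
  refine (taylor1 hu x s).trans ?_
  rw [mul_assoc]
  exact mul_le_mul_of_nonneg_left (N1_le s) hu.nonneg

lemma Lop_Q {δ : ℝ} {W : EuclideanSpace ℝ (Fin d) → ℝ} (hW : Kern d δ W)
    (h : Fin d → ℝ) (H a : ℝ) (ha : 0 < a) (ha1 : a ≤ 1) (hH0 : 0 < H)
    (hηh : ∀ i, a * H ≤ h i) (hH : ∀ i, h i ≤ H)
    {u : EuclideanSpace ℝ (Fin d) → ℝ} {M : ℝ} (hu : Smooth4 u M)
    (K : Finset (Fin d → ℤ)) (hK : ∀ k, k ∉ K → u (gridPt d h k) = 0)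
    (k0 : Fin d → ℤ) :
    |Lop W (RKfun d h (fun k => u (gridPt d h k))) (gridPt d h k0) - Lop W u (gridPt d h k0)| ≤
      d * C1 d a M * H ^ 2 := by
  have hη : 0 < a * H := by positivity
  have hh : ∀ i, 0 < h i := fun i => hη.trans_le (hηh i)
  set x := gridPt d h k0 with hx
  obtain ⟨C, hC⟩ := RK_lip h (a * H) hη hηh K _ hK
  have hQc := RK_cont h hh K _ hK
  set Q := RKfun d h (fun k => u (gridPt d h k)) with hQ
  have huc : Continuous u := hu.cd.continuous
  rw [← Lop_sub hW Q u hQc huc x C (M * d) (hC x) (u_lip hu x)]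
  have h2 := Lop_sym hW (fun y => Q y - u y) (hQc.sub huc) x (C + M * d) (fun s => by
    have a1 := hC x s
    have a2 := u_lip hu x s
    have e : Q (x + s) - u (x + s) - (Q x - u x) = (Q (x + s) - Q x) - (u (x + s) - u x) := by ring
    rw [e, add_mul]
    exact (abs_sub _ _).trans (add_le_add a1 a2))
  have h3 : |∫ s, W s * (Q (x + s) - u (x + s) + (Q (x - s) - u (x - s)) - 2 * (Q x - u x))| ≤
      ∫ s, C1 d a M * H ^ 2 * (W s * ‖s‖ ^ 2) := by
    rw [← norm_eq_abs]
    refine norm_integral_le_of_norm_le ?_ (Filter.Eventually.of_forall fun s => ?_)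
    · exact (hW.int2 (fun s => ‖s‖ ^ 2) (by fun_prop) 1 zero_le_one (fun s => by
        rw [one_mul, abs_of_nonneg (by positivity)])).const_mul _
    · have := Q_second h H a ha ha1 hH0 hηh hH hu k0 s Q hQ x hx
      rw [norm_eq_abs, abs_mul, abs_of_nonneg (hW.nonneg s)]
      have e : Q (x + s) - u (x + s) + (Q (x - s) - u (x - s)) - 2 * (Q x - u x) =
        Q (x + s) + Q (x - s) - 2 * Q x - (u (x + s) + u (x - s) - 2 * u x) := by ring
      rw [e]
      have := mul_le_mul_of_nonneg_left this (hW.nonneg s)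
      linarith
  rw [integral_const_mul, hW.mom2] at h3
  rw [← h2, abs_mul, abs_two] at h3
  linarith

lemma Q_err (h : Fin d → ℝ) (H : ℝ) (hH0 : 0 < H) (hH1 : H ≤ 1) (hh : ∀ i, 0 < h i)
    (hH : ∀ i, h i ≤ H) {u : EuclideanSpace ℝ (Fin d) → ℝ} {M : ℝ} (hu : Smooth4 u M)
    (y : EuclideanSpace ℝ (Fin d)) :
    |u y - RKfun d h (fun k => u (gridPt d h k)) y| ≤ M * (d + 16 * d ^ 4) * H ^ 2 := by
  have hM := hu.nonneg
  have h1 := Q_expand h hh H hH hu y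
  have h2 : |∑ i, h i ^ 2 / 6 * pd [i, i] u y| ≤ d * (H ^ 2 * M) := by
    refine (Finset.abs_sum_le_sum_abs _ _).trans ?_
    have := Finset.sum_le_card_nsmul (Finset.univ : Finset (Fin d))
      (fun i => |h i ^ 2 / 6 * pd [i, i] u y|) (H ^ 2 * M) (fun i _ => by
        rw [abs_mul, abs_of_nonneg (by positivity)]
        refine mul_le_mul ?_ (hu.bd [i, i] (by simp) y) (abs_nonneg _) (by positivity)
        have := pow_le_pow_left₀ (hh i).le (hH i) 2
        have := sq_nonneg (h i)
        linarith)
    simpa using this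
  have h3 : M * (2 * d * H) ^ 4 ≤ M * (16 * d ^ 4) * H ^ 2 := by
    have : H ^ 4 ≤ H ^ 2 := pow_le_pow_of_le_one hH0.le hH1 (by norm_num)
    calc M * (2 * d * H) ^ 4 = M * (16 * d ^ 4) * H ^ 4 := by ring
      _ ≤ _ := by gcongr
  rw [abs_le] at *
  constructor <;> nlinarith [h1.1, h1.2, h2.1, h2.2]

lemma RK_sq (h : Fin d → ℝ) (hh : ∀ i, 0 < h i) (K : Finset (Fin d → ℤ)) (e : (Fin d → ℤ) → ℝ)
    (he : ∀ k, k ∉ K → e k = 0) (x : EuclideanSpace ℝ (Fin d)) :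
    RKfun d h e x ^ 2 ≤ ∑ k ∈ K, e k ^ 2 * Psi d h k x := by
  classical
  obtain ⟨S, hS⟩ := exists_cov h x
  have h0 : ∑ k ∈ K, Psi d h k x ≤ 1 := by
    rw [← mom0 h hh S x hS]
    have : ∑ k ∈ Fintype.piFinset S, Psi d h k x = ∑ k ∈ K ∪ Fintype.piFinset S, Psi d h k x := by
      refine Finset.sum_subset Finset.subset_union_right fun k _ hk => ?_
      rw [Fintype.mem_piFinset, not_forall] at hk
      obtain ⟨i, hi⟩ := hk
      refine Psi_zero h hh k x i ?_
      by_contra hc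
      exact hi (hS i (k i) (not_le.mp hc))
    rw [this]
    exact Finset.sum_le_sum_of_subset_of_nonneg Finset.subset_union_left
      fun k _ _ => Psi_nonneg h hh k x
  rw [RKfun_eq h K e he]
  have h1 := Finset.sum_sq_le_sum_mul_sum_of_sq_le_mul K (r := fun k => Psi d h k x * e k)
    (f := fun k => Psi d h k x) (g := fun k => e k ^ 2 * Psi d h k x)
    (fun k _ => Psi_nonneg h hh k x)
    (fun k _ => mul_nonneg (sq_nonneg _) (Psi_nonneg h hh k x)) (fun k _ => le_of_eq (by ring))
  refine h1.trans ?_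
  exact mul_le_of_le_one_left (Finset.sum_nonneg fun k _ =>
    mul_nonneg (sq_nonneg _) (Psi_nonneg h hh k x)) h0

lemma integrable_B1 : Integrable B1 := by
  refine continuous_B1.integrable_of_hasCompactSupport ?_
  refine HasCompactSupport.intro (isCompact_Icc (a := (-2:ℝ)) (b := 2)) fun x hx => ?_
  apply B1_zero
  by_contra hc
  rw [not_le, abs_lt] at hc
  exact hx ⟨hc.1.le, hc.2.le⟩

lemma integrable_B1s (h : ℝ) (hh : 0 < h) (k : ℤ) : Integrable (fun t => B1 (t / h - k)) := by
  have := (integrable_B1.comp_sub_right (k:ℝ)).comp_div hh.ne'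
  exact this

lemma integral_B1s (h : ℝ) (hh : 0 < h) (k : ℤ) :
    ∫ t, B1 (t / h - k) = h * ∫ t, B1 t := by
  have h1 := Measure.integral_comp_div (fun t => B1 (t - k)) h
  rw [h1, integral_sub_right_eq_self (fun t => B1 t) (k:ℝ), abs_of_pos hh, smul_eq_mul]

lemma Psi_int (h : Fin d → ℝ) (hh : ∀ i, 0 < h i) (k : Fin d → ℤ) :
    Integrable (Psi d h k) ∧ ∫ x, Psi d h k x = ∏ i, (h i * ∫ t, B1 t) := by
  have e : Psi d h k = fun x => ∏ i, B1 (x i / h i - k i) := funext (Psi_eq h hh k)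
  rw [e]
  refine ⟨integrable_prodE (fun i t => B1 (t / h i - k i)) (fun i => integrable_B1s _ (hh i) _), ?_⟩
  rw [integral_prodE (fun i t => B1 (t / h i - k i))]
  exact Finset.prod_congr rfl fun i _ => integral_B1s _ (hh i) _

lemma RK_L2 (h : Fin d → ℝ) (hh : ∀ i, 0 < h i) (K : Finset (Fin d → ℤ)) (e : (Fin d → ℤ) → ℝ)
    (he : ∀ k, k ∉ K → e k = 0) (Ω : Set (EuclideanSpace ℝ (Fin d))) (P : ℝ)
    (hP : ∀ k, ∫ x in Ω, Psi d h k x ≤ P) :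
    ∫ x in Ω, RKfun d h e x ^ 2 ≤ P * ∑ k ∈ K, e k ^ 2 := by
  have hi : ∀ k, IntegrableOn (Psi d h k) Ω := fun k => (Psi_int h hh k).1.integrableOn
  calc ∫ x in Ω, RKfun d h e x ^ 2 ≤ ∫ x in Ω, ∑ k ∈ K, e k ^ 2 * Psi d h k x := by
        refine integral_mono_of_nonneg (Filter.Eventually.of_forall fun x => sq_nonneg _)
          (integrable_finsetSum _ fun k _ => (hi k).const_mul _)
          (Filter.Eventually.of_forall fun x => RK_sq h hh K e he x)
    _ = ∑ k ∈ K, e k ^ 2 * ∫ x in Ω, Psi d h k x := by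
        rw [integral_finsetSum _ fun k _ => (hi k).const_mul _]
        simp only [integral_const_mul]
    _ ≤ ∑ k ∈ K, e k ^ 2 * P := Finset.sum_le_sum fun k _ =>
        mul_le_mul_of_nonneg_left (hP k) (sq_nonneg _)
    _ = _ := by rw [← Finset.sum_mul]; ring

lemma norm_le_N1 (z : EuclideanSpace ℝ (Fin d)) : ‖z‖ ≤ N1 z := by
  have hz : z = ∑ j, EuclideanSpace.single j (z j) := by
    ext i
    simp [Finset.sum_apply, Pi.single_apply]
  conv_lhs => rw [hz]
  refine (norm_sum_le _ _).trans (le_of_eq ?_)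
  simp [N1]

lemma Tk_supp (h : Fin d → ℝ) (hh : ∀ i, 0 < h i) (H : ℝ) (hH : ∀ i, h i ≤ H) (k : Fin d → ℤ)
    (R : ℝ) (hR : ‖gridPt d h k‖ ≤ R) (x : EuclideanSpace ℝ (Fin d)) (hx : R + d * H < ‖x‖) :
    Tk h k x = 0 := by
  by_contra hne
  have h1 : ∀ i, |x i / h i - k i| ≤ 1 := by
    intro i
    by_contra hc
    refine hne (Finset.prod_eq_zero (Finset.mem_univ i) (hat_zero (not_le.mp hc).le))
  have h2 := N1_grid h hh H hH k x 1 h1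
  have h3 := norm_le_N1 (gridPt d h k - x)
  have h4 := norm_sub_norm_le x (gridPt d h k)
  rw [norm_sub_rev] at h4
  linarith

lemma exists_K (h : Fin d → ℝ) (η : ℝ) (hη : 0 < η) (hh : ∀ i, η ≤ h i)
    (Ω : Set (EuclideanSpace ℝ (Fin d))) (R : ℝ) (hR0 : 0 ≤ R) (hR : ∀ x ∈ Ω, ‖x‖ ≤ R) :
    ∃ K : Finset (Fin d → ℤ), (∀ k, k ∈ K ↔ gridPt d h k ∈ Ω) ∧
      (K.card : ℝ) ≤ (2 * R / η + 1) ^ d := by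
  classical
  set B := Fintype.piFinset (fun _ : Fin d => Finset.Icc (-⌊R / η⌋) ⌊R / η⌋) with hB
  refine ⟨B.filter fun k => gridPt d h k ∈ Ω, fun k => ?_, ?_⟩
  · rw [Finset.mem_filter, and_iff_right_iff_imp]
    intro hk
    rw [hB, Fintype.mem_piFinset]
    intro i
    have h1 : |(k i : ℝ)| ≤ R / η := by
      have h2 := (coord_le _ i).trans (hR _ hk)
      rw [gridPt_apply, abs_mul, abs_of_pos (hη.trans_le (hh i))] at h2
      rw [le_div_iff₀ hη]
      exact (mul_le_mul_of_nonneg_left (hh i) (abs_nonneg _)).trans h2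
    have h2 : |k i| ≤ ⌊R / η⌋ := by
      rw [Int.le_floor]; push_cast; exact h1
    rw [abs_le] at h2
    exact Finset.mem_Icc.mpr h2
  · have h0 : 0 ≤ ⌊R / η⌋ := Int.floor_nonneg.mpr (by positivity)
    have h1 : ((Finset.Icc (-⌊R / η⌋) ⌊R / η⌋).card : ℝ) ≤ 2 * R / η + 1 := by
      rw [Int.card_Icc]
      have : (((⌊R / η⌋ + 1 - -⌊R / η⌋).toNat : ℤ) : ℝ) = 2 * ⌊R / η⌋ + 1 := by
        rw [Int.toNat_of_nonneg (by omega)]; push_cast; ring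
      have h3 : (((⌊R / η⌋ + 1 - -⌊R / η⌋).toNat : ℕ) : ℝ) = 2 * ⌊R / η⌋ + 1 := by
        rw [← this]; norm_cast
      rw [h3]
      have := Int.floor_le (R / η)
      rw [mul_div_assoc]; linarith
    have h2 : ((B.filter fun k => gridPt d h k ∈ Ω).card : ℝ) ≤ B.card := by
      exact_mod_cast Finset.card_filter_le _ _
    refine h2.trans ?_
    rw [hB, Fintype.card_piFinset]
    push_cast
    rw [Finset.prod_const]
    simp only [Finset.card_univ, Fintype.card_fin]
    exact pow_le_pow_left₀ (by positivity) h1 d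

lemma stab {δ : ℝ} {W : EuclideanSpace ℝ (Fin d) → ℝ} (hd : 1 ≤ d) (hδ : 0 < δ) (hW : Kern d δ W)
    (h : Fin d → ℝ) (hh : ∀ i, 0 < h i) (H : ℝ) (hH0 : 0 < H) (hH : ∀ i, h i ≤ H)
    (K : Finset (Fin d → ℤ)) (R : ℝ) (hR0 : 0 ≤ R)
    (hKR : ∀ k ∈ K, ‖gridPt d h k‖ ≤ R) (e : (Fin d → ℤ) → ℝ)
    (he : ∀ k, k ∉ K → e k = 0) (r : ℝ)
    (hr : ∀ k ∈ K, |Lop W (RKfun d h e) (gridPt d h k)| ≤ r) :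
    ∑ k ∈ K, e k ^ 2 ≤ (4 ^ d * (2 * (R + d * H) + δ) ^ 2) ^ 2 * r ^ 2 * K.card := by
  have h1 := stab_aux hd hδ hW h hh K e he (2 * (R + d * H)) (by positivity) (fun k hk x hx =>
    Tk_supp h hh H hH k R (hKR k hk) x (by linarith))
  set A := 4 ^ d * (2 * (R + d * H) + δ) ^ 2 with hA
  have hA0 : 0 ≤ A := by positivity
  set T := ∑ k ∈ K, e k ^ 2 with hT
  have hT0 : 0 ≤ T := Finset.sum_nonneg fun k _ => sq_nonneg _
  set Y := ∑ k ∈ K, |e k| with hY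
  have h2 : ∑ k ∈ K, e k * (-(Lop W (RKfun d h e) (gridPt d h k))) ≤ r * Y := by
    rw [hY, Finset.mul_sum]
    refine Finset.sum_le_sum fun k hk => (le_abs_self _).trans ?_
    rw [abs_mul, abs_neg, mul_comm]
    exact mul_le_mul_of_nonneg_right (hr k hk) (abs_nonneg _)
  have h3 : T ≤ A * (r * Y) := h1.trans (mul_le_mul_of_nonneg_left h2 hA0)
  have h4 : Y ^ 2 ≤ K.card * T := by
    have := sq_sum_le_card_mul_sum_sq (s := K) (f := fun k => |e k|)
    simpa [hY, hT] using this
  rcases hT0.eq_or_lt with h0 | h0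
  · rw [← h0]; positivity
  · have h5 : T ^ 2 ≤ (A * (r * Y)) ^ 2 := pow_le_pow_left₀ hT0 h3 2
    have h6 : T * T ≤ (A ^ 2 * r ^ 2 * K.card) * T := by
      have := mul_le_mul_of_nonneg_left h4 (by positivity : 0 ≤ A ^ 2 * r ^ 2)
      nlinarith
    exact le_of_mul_le_mul_right h6 h0

lemma sq_split (Ω : Set (EuclideanSpace ℝ (Fin d))) (hb : Bornology.IsBounded Ω)
    (f g : EuclideanSpace ℝ (Fin d) → ℝ) (hf : Continuous f) (hg : Continuous g) :
    ∫ x in Ω, (f x - g x) ^ 2 ≤ 2 * (∫ x in Ω, f x ^ 2) + 2 * ∫ x in Ω, g x ^ 2 := by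
  have hc : ∀ f : EuclideanSpace ℝ (Fin d) → ℝ, Continuous f → IntegrableOn f Ω := by
    intro f hf
    obtain ⟨R, hR⟩ := hb.subset_closedBall 0
    exact (hf.continuousOn.integrableOn_compact (isCompact_closedBall 0 R)).mono_set hR
  have i1 : IntegrableOn (fun x => 2 * f x ^ 2) Ω := (hc _ (hf.pow 2)).const_mul 2
  have i2 : IntegrableOn (fun x => 2 * g x ^ 2) Ω := (hc _ (hg.pow 2)).const_mul 2
  rw [← integral_const_mul, ← integral_const_mul, ← integral_add i1 i2]
  have i3 : IntegrableOn (fun x => (f x - g x) ^ 2) Ω := hc _ ((hf.sub hg).pow 2)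
  refine integral_mono i3 (i1.add i2) fun x => ?_
  have : 0 ≤ (f x + g x) ^ 2 := sq_nonneg _
  simp only [Pi.add_apply, Pi.pow_apply]
  nlinarith

lemma sq_const (Ω : Set (EuclideanSpace ℝ (Fin d))) (hb : Bornology.IsBounded Ω)
    (f : EuclideanSpace ℝ (Fin d) → ℝ) (B : ℝ) (hB : ∀ x, |f x| ≤ B) :
    ∫ x in Ω, f x ^ 2 ≤ volume.real Ω * B ^ 2 := by
  have h1 : ∫ x in Ω, B ^ 2 = volume.real Ω * B ^ 2 := by
    rw [setIntegral_const, smul_eq_mul]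
  rw [← h1]
  refine integral_mono_of_nonneg (Filter.Eventually.of_forall fun x => sq_nonneg _)
    (integrableOn_const (hb.measure_lt_top.ne)) (Filter.Eventually.of_forall fun x => ?_)
  have := pow_le_pow_left₀ (abs_nonneg _) (hB x) 2
  simpa [sq_abs] using this

end s8

end part8

set_option maxHeartbeats 2000000

/-- Asymptotic compatibility: if `u⁰ ∈ C⁴` vanishes outside `Ω` with
derivatives up to order 4 bounded by `M`, `f₀ = −Δu⁰`, `f_δ` is within `Mδ²` of `f₀` on `Ω`,
and `u^{δ,h} ∈ S(□∩Ω)` solves `−L_δ u^{δ,h}(x_k) = f_δ(x_k)` at all grid points in `Ω`,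
then `‖u⁰ − u^{δ,h}‖_{L²(Ω)} ≤ C (h_max² + δ²)`. -/
theorem rk_collocation_asymptotic_compatibility (d : ℕ) (hd : 1 ≤ d) (ρ : ℝ → ℝ)
    (hρ_nonneg : ∀ r, 0 ≤ ρ r)
    (hρ_mono : ∀ r₁ r₂, 0 ≤ r₁ → r₁ ≤ r₂ → ρ r₂ ≤ ρ r₁)
    (hρ_supp : ∀ r, 1 < r → ρ r = 0)
    (hρ_mom2 : ∫ s in Metric.ball (0 : EuclideanSpace ℝ (Fin d)) 1,
        ρ ‖s‖ * ‖s‖^2 = 2 * d)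
    (hρ_mom1 : IntegrableOn (fun s : EuclideanSpace ℝ (Fin d) => ρ ‖s‖ * ‖s‖)
        (Metric.ball 0 1))
    (Ω : Set (EuclideanSpace ℝ (Fin d))) (hΩo : IsOpen Ω)
    (hΩb : Bornology.IsBounded Ω) (hΩc : IsConnected Ω)
    (δ₀ : ℝ) (hδ₀ : 0 < δ₀) (M : ℝ) (hM : 0 < M)
    (hhat : Fin d → ℝ) (hhat_mem : ∀ j, 0 < hhat j ∧ hhat j ≤ 1)
    (hhat_max : ∃ j, hhat j = 1) :
    ∃ C : ℝ, 0 < C ∧ ∀ δ : ℝ, 0 < δ → δ ≤ δ₀ → ∀ hmax : ℝ, 0 < hmax →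
      ∀ u0 : EuclideanSpace ℝ (Fin d) → ℝ, ContDiff ℝ 4 u0 →
      (∀ x, x ∉ Ω → u0 x = 0) →
      (∀ β : Fin d → ℕ, (∑ j, β j) ≤ 4 → ∀ y, |multiDeriv d β u0 y| ≤ M) →
      ∀ fδ : EuclideanSpace ℝ (Fin d) → ℝ,
        (∀ x ∈ Ω, |fδ x - (-(laplacian d u0 x))| ≤ M * δ^2) →
      ∀ c : (Fin d → ℤ) → ℝ,
        (∀ k, gridPt d (fun j => hmax * hhat j) k ∉ Ω → c k = 0) →
        (∀ k, gridPt d (fun j => hmax * hhat j) k ∈ Ω →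
          -(nonlocalOp d ρ δ (RKfun d (fun j => hmax * hhat j) c)
              (gridPt d (fun j => hmax * hhat j) k)) =
            fδ (gridPt d (fun j => hmax * hhat j) k)) →
        Real.sqrt (∫ x in Ω, (u0 x - RKfun d (fun j => hmax * hhat j) c x)^2) ≤
          C * (hmax^2 + δ^2) := by
  classical
  obtain ⟨j0, hj0⟩ := hhat_max
  obtain ⟨jm, hjm⟩ : ∃ jm, ∀ j, hhat jm ≤ hhat j := by
    have : Nonempty (Fin d) := ⟨j0⟩
    exact Finite.exists_min hhat
  set a := hhat jm with ha_def
  have ha : 0 < a := (hhat_mem jm).1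
  have ha1 : a ≤ 1 := (hhat_mem jm).2
  obtain ⟨R, hR0, hR⟩ : ∃ R : ℝ, 0 ≤ R ∧ ∀ x ∈ Ω, ‖x‖ ≤ R := by
    obtain ⟨R, hR⟩ := hΩb.subset_closedBall 0
    refine ⟨max R 0, le_max_right _ _, fun x hx => ?_⟩
    have := hR hx
    rw [mem_closedBall_zero_iff] at this
    exact this.trans (le_max_left _ _)
  set V := volume.real Ω with hV
  have hV0 : 0 ≤ V := measureReal_nonneg
  set β := ∫ t, B1 t with hβ
  have hβ0 : 0 ≤ β := integral_nonneg B1_nonneg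
  set b := 2 * R / a + 1 with hb
  have hb0 : 0 ≤ b := by positivity
  set A1 : ℝ := 4 ^ d * (2 * (R + d) + δ₀) ^ 2 with hA1
  have hA10 : 0 ≤ A1 := by positivity
  have hC1 := C1_nonneg d a M hM.le
  set r0 : ℝ := M + 2 * d ^ 5 * M + d * C1 d a M with hr0
  have hr00 : 0 ≤ r0 := by positivity
  set r1 : ℝ := d * M + M * δ₀ ^ 2 with hr1
  have hr10 : 0 ≤ r1 := by positivity
  set X1 : ℝ := 2 * (V * (M * (d + 16 * d ^ 4)) ^ 2) + 2 * (A1 ^ 2 * r0 ^ 2 * (b * β) ^ d) with hX1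
  set X2 : ℝ := 2 * (V * M ^ 2) + 2 * (V * (A1 ^ 2 * r1 ^ 2 * b ^ d)) with hX2
  have hX10 : 0 ≤ X1 := by positivity
  have hX20 : 0 ≤ X2 := by positivity
  refine ⟨Real.sqrt (X1 + X2 + 1), Real.sqrt_pos.mpr (by positivity), ?_⟩
  intro δ hδ hδ1 H hH0 u hu hu0 hub f hf c hc0 hc
  have hS : Smooth4 u M := ⟨by exact_mod_cast hu, fun l hl y => pd_bound u hu M hub l hl y⟩
  set h : Fin d → ℝ := fun j => H * hhat j with hh_def
  have hη : 0 < a * H := by positivity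
  have hηh : ∀ i, a * H ≤ h i := fun i => by
    rw [mul_comm]; exact mul_le_mul_of_nonneg_left (hjm i) hH0.le
  have hhH : ∀ i, h i ≤ H := fun i => mul_le_of_le_one_right hH0.le (hhat_mem i).2
  have hh : ∀ i, 0 < h i := fun i => hη.trans_le (hηh i)
  have hW := kern_WW ρ hρ_nonneg hρ_mono hρ_mom2 hρ_mom1 δ hδ
  set W := WW d ρ δ with hWd
  simp only [nonlocalOp_eq, ← hWd] at hc
  obtain ⟨K, hK, hKc⟩ := exists_K h (a * H) hη hηh Ω R hR0 hR
  have hcK : ∀ k, k ∉ K → c k = 0 := fun k hk => hc0 k (fun h' => hk ((hK k).2 h'))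
  have hKR : ∀ k ∈ K, ‖gridPt d h k‖ ≤ R := fun k hk => hR _ ((hK k).1 hk)
  have huK : ∀ k, k ∉ K → u (gridPt d h k) = 0 := fun k hk => hu0 _ (fun h' => hk ((hK k).2 h'))
  have huc : Continuous u := hu.continuous
  have hcc := RK_cont h hh K c hcK
  suffices hmain : ∫ x in Ω, (u x - RKfun d h c x) ^ 2 ≤ (X1 + X2 + 1) * (H ^ 2 + δ ^ 2) ^ 2 by
    have := Real.sqrt_le_sqrt hmain
    rwa [Real.sqrt_mul (by positivity), Real.sqrt_sq (by positivity)] at this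
  rcases le_total H 1 with hH1 | hH1
  · set Q := RKfun d h (fun k => u (gridPt d h k)) with hQ
    set e : (Fin d → ℤ) → ℝ := fun k => c k - u (gridPt d h k) with he
    have heK : ∀ k, k ∉ K → e k = 0 := fun k hk => by simp only [he, hcK k hk, huK k hk, sub_zero]
    have hRe : ∀ x, RKfun d h e x = RKfun d h c x - Q x := RK_sub h K c _ hcK huK
    have hQc := RK_cont h hh K _ huK
    have hec := RK_cont h hh K e heK
    have hres : ∀ k ∈ K, |Lop W (RKfun d h e) (gridPt d h k)| ≤ r0 * (H ^ 2 + δ ^ 2) := by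
      intro k hk
      obtain ⟨D1, hD1⟩ := RK_lip h (a * H) hη hηh K c hcK
      obtain ⟨D2, hD2⟩ := RK_lip h (a * H) hη hηh K _ huK
      rw [funext hRe, Lop_sub hW _ _ hcc hQc (gridPt d h k) D1 D2 (hD1 _) (hD2 _)]
      have b1 := hf _ ((hK k).1 hk)
      have b2 := hc k ((hK k).1 hk)
      have b3 := Lop_consist hW hS (gridPt d h k)
      have b4 := Lop_Q hW h H a ha ha1 hH0 hηh hhH hS K huK k
      rw [← hQ] at b4
      have b5 : M * δ ^ 2 + 2 * d ^ 5 * M * δ ^ 2 + d * C1 d a M * H ^ 2 ≤ r0 * (H ^ 2 + δ ^ 2) := by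
        have q1 : 0 ≤ d * C1 d a M * δ ^ 2 + (M + 2 * d ^ 5 * M) * H ^ 2 := by positivity
        have q2 : r0 * (H ^ 2 + δ ^ 2) = M * δ ^ 2 + 2 * d ^ 5 * M * δ ^ 2 + d * C1 d a M * H ^ 2 +
          (d * C1 d a M * δ ^ 2 + (M + 2 * d ^ 5 * M) * H ^ 2) := by rw [hr0]; ring
        rw [q2]; exact le_add_of_nonneg_right q1
      refine le_trans ?_ b5
      rw [← b2] at b1
      rw [abs_le] at b1 b3 b4 ⊢
      constructor <;> linarith only [b1.1, b1.2, b3.1, b3.2, b4.1, b4.2]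
    have hst := stab hd hδ hW h hh H hH0 hhH K R hR0 hKR e heK _ hres
    have hP : ∀ k, ∫ x in Ω, Psi d h k x ≤ (H * β) ^ d := by
      intro k
      obtain ⟨i1, i2⟩ := Psi_int h hh k
      refine (setIntegral_le_integral i1 (Filter.Eventually.of_forall (Psi_nonneg h hh k))).trans ?_
      rw [i2]
      refine (Finset.prod_le_prod (fun i _ => mul_nonneg (hh i).le hβ0)
        (fun i _ => mul_le_mul_of_nonneg_right (hhH i) hβ0)).trans (le_of_eq ?_)
      simp
    have hL2 := RK_L2 h hh K e heK Ω _ hP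
    have hsp := sq_split Ω hΩb (fun x => u x - Q x) (RKfun d h e) (huc.sub hQc) hec
    have hcst := sq_const Ω hΩb (fun x => u x - Q x) _ (Q_err h H hH0 hH1 hh hhH hS)
    have e1 : ∀ x, u x - Q x - RKfun d h e x = u x - RKfun d h c x := fun x => by rw [hRe]; ring
    simp only [e1] at hsp
    have hA : (4 ^ d * (2 * (R + d * H) + δ) ^ 2) ≤ A1 := by
      rw [hA1]; gcongr
      exact mul_le_of_le_one_right (by positivity) hH1
    have hN : (H * β) ^ d * K.card ≤ (b * β) ^ d := by
      calc (H * β) ^ d * K.card ≤ (H * β) ^ d * (2 * R / (a * H) + 1) ^ d := by gcongr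
        _ = (H * β * (2 * R / (a * H) + 1)) ^ d := by rw [mul_pow (H * β)]
        _ ≤ (b * β) ^ d := by
          refine pow_le_pow_left₀ (by positivity) ?_ d
          have : H * β * (2 * R / (a * H) + 1) = (2 * R / a + H) * β := by field_simp
          rw [this, hb]; gcongr
    have h5 : ∫ x in Ω, RKfun d h e x ^ 2 ≤
        A1 ^ 2 * r0 ^ 2 * (b * β) ^ d * (H ^ 2 + δ ^ 2) ^ 2 := by
      refine hL2.trans ?_
      calc _ ≤ (H * β) ^ d * ((4 ^ d * (2 * (R + d * H) + δ) ^ 2) ^ 2 *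
            (r0 * (H ^ 2 + δ ^ 2)) ^ 2 * K.card) := by gcongr
        _ ≤ (H * β) ^ d * (A1 ^ 2 * (r0 * (H ^ 2 + δ ^ 2)) ^ 2 * K.card) := by gcongr
        _ = A1 ^ 2 * (r0 * (H ^ 2 + δ ^ 2)) ^ 2 * ((H * β) ^ d * K.card) := by ring
        _ ≤ A1 ^ 2 * (r0 * (H ^ 2 + δ ^ 2)) ^ 2 * (b * β) ^ d := by gcongr
        _ = _ := by ring
    have h6 : V * (M * (d + 16 * d ^ 4) * H ^ 2) ^ 2 ≤
        V * (M * (d + 16 * d ^ 4)) ^ 2 * (H ^ 2 + δ ^ 2) ^ 2 := by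
      rw [mul_pow _ (H ^ 2), ← mul_assoc]
      gcongr
      have := sq_nonneg δ
      linarith
    have h7 : ∫ x in Ω, (u x - RKfun d h c x) ^ 2 ≤ X1 * (H ^ 2 + δ ^ 2) ^ 2 := by
      rw [hX1]; linarith only [h5, h6, hsp, hcst]
    refine h7.trans ?_
    refine mul_le_mul_of_nonneg_right ?_ (sq_nonneg _)
    linarith only [hX10, hX20]
  · have hlap : ∀ x, |laplacian d u x| ≤ d * M := by
      intro x
      rw [laplacian_eq]
      refine (Finset.abs_sum_le_sum_abs _ _).trans ?_
      have := Finset.sum_le_card_nsmul (Finset.univ : Finset (Fin d))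
        (fun i => |pd [i, i] u x|) M (fun i _ => hS.bd [i, i] (by simp) x)
      simpa using this
    have hres : ∀ k ∈ K, |Lop W (RKfun d h c) (gridPt d h k)| ≤ r1 := by
      intro k hk
      have b1 := hf _ ((hK k).1 hk)
      have b2 := hc k ((hK k).1 hk)
      have b3 := hlap (gridPt d h k)
      have b4 : M * δ ^ 2 ≤ M * δ₀ ^ 2 := by gcongr
      rw [← b2] at b1
      rw [hr1]
      rw [abs_le] at b1 b3 ⊢
      constructor <;> linarith only [b1.1, b1.2, b3.1, b3.2, b4]
    have hst := stab hd hδ hW h hh H hH0 hhH K R hR0 hKR c hcK _ hres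
    have hP : ∀ k, ∫ x in Ω, Psi d h k x ≤ V := by
      intro k
      have h1 : ∫ x in Ω, (1:ℝ) = V := by simp [hV]
      rw [← h1]
      refine integral_mono_of_nonneg (Filter.Eventually.of_forall (Psi_nonneg h hh k))
        (integrableOn_const (hΩb.measure_lt_top.ne))
        (Filter.Eventually.of_forall fun x => Psi_le_one h hh k x)
    have hL2 := RK_L2 h hh K c hcK Ω _ hP
    have hsp := sq_split Ω hΩb u (RKfun d h c) huc hcc
    have hcst := sq_const Ω hΩb u M (fun x => hS.bd [] (by simp) x)
    have hA : (4 ^ d * (2 * (R + d * H) + δ) ^ 2) ≤ A1 * H ^ 2 := by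
      rw [hA1, mul_assoc, ← mul_pow]; gcongr
      have q1 : R ≤ R * H := le_mul_of_one_le_right hR0 hH1
      have q2 : δ₀ ≤ δ₀ * H := le_mul_of_one_le_right hδ₀.le hH1
      have q3 : (2 * (R + d) + δ₀) * H = 2 * (R * H + d * H) + δ₀ * H := by ring
      rw [q3]
      linarith only [q1, q2, hδ1]
    have hN : (K.card : ℝ) ≤ b ^ d := by
      refine hKc.trans (pow_le_pow_left₀ (by positivity) ?_ d)
      rw [hb]; gcongr
      exact le_mul_of_one_le_right ha.le hH1
    have hHd : H ^ 2 ≤ H ^ 2 + δ ^ 2 := by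
      have := sq_nonneg δ
      linarith
    have h5 : ∫ x in Ω, RKfun d h c x ^ 2 ≤
        V * (A1 ^ 2 * r1 ^ 2 * b ^ d) * (H ^ 2 + δ ^ 2) ^ 2 := by
      refine hL2.trans ?_
      calc _ ≤ V * ((4 ^ d * (2 * (R + d * H) + δ) ^ 2) ^ 2 * r1 ^ 2 * K.card) := by gcongr
        _ ≤ V * ((A1 * H ^ 2) ^ 2 * r1 ^ 2 * b ^ d) := by gcongr
        _ = V * (A1 ^ 2 * r1 ^ 2 * b ^ d) * (H ^ 2) ^ 2 := by ring
        _ ≤ _ := by gcongr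
    have h6 : V * M ^ 2 ≤ V * M ^ 2 * (H ^ 2 + δ ^ 2) ^ 2 := by
      refine le_mul_of_one_le_right (by positivity) (one_le_pow₀ ?_)
      exact (one_le_pow₀ hH1).trans hHd
    have h7 : ∫ x in Ω, (u x - RKfun d h c x) ^ 2 ≤ X2 * (H ^ 2 + δ ^ 2) ^ 2 := by
      rw [hX2]; linarith only [h5, h6, hsp, hcst]
    refine h7.trans ?_
    refine mul_le_mul_of_nonneg_right ?_ (sq_nonneg _)
    linarith only [hX10, hX20]

end
end

section
/- (Positive quadrature weights in two dimensions.) Let d = 2 and let B be a finite subset of the closed unit ball of ℝ² minus the origin which is invariant under the maps (s₁,s₂) ↦ (−s₁,s₂), (s₁,s₂) ↦ (s₁,−s₂) and (s₁,s₂) ↦ (s₂,s₁). Set m̃₂₂ := Σ_{s∈B} s₁² s₂² ρ(|s|) φ(|s|) and m̃₄₀ := Σ_{s∈B} s₁⁴ ρ(|s|) φ(|s|), and assume m̃₂₂ + m̃₄₀ > 0. Define ω(s) := φ(|s|)|s|²/(m̃₂₂ + m̃₄₀). Then ω(s) ≥ 0 for all s ∈ B, Σ_{s∈B} ω(s) ρ(|s|)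 s₁ = Σ_{s∈B} ω(s) ρ(|s|) s₂ = Σ_{s∈B} ω(s) ρ(|s|) s₁ s₂ = 0, and Σ_{s∈B} ω(s) ρ(|s|) s₁² = Σ_{s∈B} ω(s) ρ(|s|) s₂² = 1; consequently 2 Σ_{s∈B} ω(s) ρ(|s|) s_i s_j = ∫_{B_1(0)} ρ(|s|) s_i s_j ds for all i, j ∈ {1,2}. -/
open MeasureTheory Real
open scoped BigOperators

noncomputable section

/-- Build a point of `ℝ²` (as a Euclidean space) from its two coordinates. -/
def mkE2 (a b : ℝ) : EuclideanSpace ℝ (Fin 2) :=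
  (EuclideanSpace.equiv (Fin 2) ℝ).symm ![a, b]

/-- The moment `m̃₂₂ = Σ_{s∈B} s₁²s₂² ρ(|s|) φ(|s|)`. -/
def m22 (ρ : ℝ → ℝ) (B : Finset (EuclideanSpace ℝ (Fin 2))) : ℝ :=
  ∑ s ∈ B, (s 0)^2 * (s 1)^2 * ρ ‖s‖ * phi ‖s‖

/-- The moment `m̃₄₀ = Σ_{s∈B} s₁⁴ ρ(|s|) φ(|s|)`. -/
def m40 (ρ : ℝ → ℝ) (B : Finset (EuclideanSpace ℝ (Fin 2))) : ℝ :=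
  ∑ s ∈ B, (s 0)^4 * ρ ‖s‖ * phi ‖s‖

/-- The quadrature weight `ω(s) = φ(|s|)|s|²/(m̃₂₂ + m̃₄₀)`. -/
def weight17 (ρ : ℝ → ℝ) (B : Finset (EuclideanSpace ℝ (Fin 2)))
    (s : EuclideanSpace ℝ (Fin 2)) : ℝ :=
  phi ‖s‖ * ‖s‖^2 / (m22 ρ B + m40 ρ B)

theorem phi_nonneg_aux (x : ℝ) (hx : 0 ≤ x) : 0 ≤ phi x := by
  unfold phi
  split_ifs with h1 h2
  · nlinarith [mul_nonneg hx (sub_nonneg.2 h1), mul_nonneg hx hx, pow_nonneg hx 3]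
  · have : 0 ≤ 1 - x := by linarith
    positivity
  · exact le_rfl

theorem int_inv_aux (L : EuclideanSpace ℝ (Fin 2) ≃ₗᵢ[ℝ] EuclideanSpace ℝ (Fin 2))
    (f : EuclideanSpace ℝ (Fin 2) → ℝ) :
    ∫ s in Metric.ball (0 : EuclideanSpace ℝ (Fin 2)) 1, f (L s) =
    ∫ s in Metric.ball (0 : EuclideanSpace ℝ (Fin 2)) 1, f s := by
  have h := L.measurePreserving.setIntegral_preimage_emb
    L.toHomeomorph.measurableEmbedding f (Metric.ball 0 1)
  have h2 : L ⁻¹' (Metric.ball (0 : EuclideanSpace ℝ (Fin 2)) 1) = Metric.ball 0 1 := by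
    ext s; simp
  rw [h2] at h
  exact h

def LSwap : EuclideanSpace ℝ (Fin 2) ≃ₗᵢ[ℝ] EuclideanSpace ℝ (Fin 2) :=
  LinearIsometryEquiv.piLpCongrLeft 2 ℝ ℝ (Equiv.swap (0 : Fin 2) 1)

def LRefl (k : Fin 2) : EuclideanSpace ℝ (Fin 2) ≃ₗᵢ[ℝ] EuclideanSpace ℝ (Fin 2) :=
  LinearIsometryEquiv.piLpCongrRight 2
    (fun i => if i = k then LinearIsometryEquiv.neg ℝ else LinearIsometryEquiv.refl ℝ ℝ)

theorem LSwap_0 (s : EuclideanSpace ℝ (Fin 2)) : LSwap s 0 = s 1 := by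
  simp [LSwap, LinearIsometryEquiv.piLpCongrLeft_apply, Equiv.piCongrLeft'_apply]
theorem LSwap_1 (s : EuclideanSpace ℝ (Fin 2)) : LSwap s 1 = s 0 := by
  simp [LSwap, LinearIsometryEquiv.piLpCongrLeft_apply, Equiv.piCongrLeft'_apply]
theorem LRefl_app (k i : Fin 2) (s : EuclideanSpace ℝ (Fin 2)) :
    LRefl k s i = if i = k then - s i else s i := by
  simp only [LRefl, LinearIsometryEquiv.piLpCongrRight_apply]
  split_ifs with h <;> simp

theorem sum_inv_aux (L : EuclideanSpace ℝ (Fin 2) ≃ₗᵢ[ℝ] EuclideanSpace ℝ (Fin 2))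
    (hL : ∀ s, L (L s) = s)
    (B : Finset (EuclideanSpace ℝ (Fin 2))) (hB : ∀ s ∈ B, L s ∈ B)
    (f : EuclideanSpace ℝ (Fin 2) → ℝ) :
    ∑ s ∈ B, f (L s) = ∑ s ∈ B, f s :=
  Finset.sum_nbij' L L hB hB (fun s _ => hL s) (fun s _ => hL s) (fun _ _ => rfl)

theorem ext_aux {s t : EuclideanSpace ℝ (Fin 2)} (h0 : s 0 = t 0) (h1 : s 1 = t 1) : s = t := by
  ext i; fin_cases i <;> assumption

theorem normsq_aux (s : EuclideanSpace ℝ (Fin 2)) : ‖s‖^2 = (s 0)^2 + (s 1)^2 := by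
  simp [EuclideanSpace.norm_sq_eq, Fin.sum_univ_two]

/-- Positive quadrature weights in two dimensions. -/
theorem positive_quadrature_weights_2d (ρ : ℝ → ℝ)
    (hρ_nonneg : ∀ r, 0 ≤ ρ r)
    (hρ_mono : ∀ r₁ r₂, 0 ≤ r₁ → r₁ ≤ r₂ → ρ r₂ ≤ ρ r₁)
    (hρ_supp : ∀ r, 1 < r → ρ r = 0)
    (hρ_mom2 : ∫ s in Metric.ball (0 : EuclideanSpace ℝ (Fin 2)) 1,
        ρ ‖s‖ * ‖s‖^2 = 4)
    (B : Finset (EuclideanSpace ℝ (Fin 2)))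
    (hB : ∀ s ∈ B, ‖s‖ ≤ 1 ∧ s ≠ 0)
    (hinv1 : ∀ s ∈ B, mkE2 (-(s 0)) (s 1) ∈ B)
    (hinv2 : ∀ s ∈ B, mkE2 (s 0) (-(s 1)) ∈ B)
    (hinv3 : ∀ s ∈ B, mkE2 (s 1) (s 0) ∈ B)
    (hpos : 0 < m22 ρ B + m40 ρ B) :
    (∀ s ∈ B, 0 ≤ weight17 ρ B s) ∧
    (∑ s ∈ B, weight17 ρ B s * ρ ‖s‖ * s 0) = 0 ∧
    (∑ s ∈ B, weight17 ρ B s * ρ ‖s‖ * s 1) = 0 ∧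
    (∑ s ∈ B, weight17 ρ B s * ρ ‖s‖ * (s 0 * s 1)) = 0 ∧
    (∑ s ∈ B, weight17 ρ B s * ρ ‖s‖ * (s 0)^2) = 1 ∧
    (∑ s ∈ B, weight17 ρ B s * ρ ‖s‖ * (s 1)^2) = 1 ∧
    (∀ i j : Fin 2,
      2 * ∑ s ∈ B, weight17 ρ B s * ρ ‖s‖ * (s i * s j) =
        ∫ s in Metric.ball (0 : EuclideanSpace ℝ (Fin 2)) 1, ρ ‖s‖ * (s i * s j)) := by
  have mk0 : ∀ a b, mkE2 a b 0 = a := fun a b => by simp [mkE2]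
  have mk1 : ∀ a b, mkE2 a b 1 = b := fun a b => by simp [mkE2]
  have hw : ∀ (L : EuclideanSpace ℝ (Fin 2) ≃ₗᵢ[ℝ] EuclideanSpace ℝ (Fin 2)) s,
      weight17 ρ B (L s) = weight17 ρ B s := by
    intro L s; simp [weight17]
  have e0 : ∀ s, LRefl 0 s = mkE2 (-(s 0)) (s 1) := fun s =>
    ext_aux (by rw [mk0, LRefl_app]; simp) (by rw [mk1, LRefl_app]; simp)
  have e1 : ∀ s, LRefl 1 s = mkE2 (s 0) (-(s 1)) := fun s =>
    ext_aux (by rw [mk0, LRefl_app]; simp) (by rw [mk1, LRefl_app]; simp)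
  have i0 : ∀ s, LRefl 0 (LRefl 0 s) = s := fun s =>
    ext_aux (by simp [LRefl_app]) (by simp [LRefl_app])
  have i1 : ∀ s, LRefl 1 (LRefl 1 s) = s := fun s =>
    ext_aux (by simp [LRefl_app]) (by simp [LRefl_app])
  have i2 : ∀ s, LSwap (LSwap s) = s := fun s =>
    ext_aux (by rw [LSwap_0, LSwap_1]) (by rw [LSwap_1, LSwap_0])
  have e2 : ∀ s, LSwap s = mkE2 (s 1) (s 0) := fun s =>
    ext_aux (by rw [mk0, LSwap_0]) (by rw [mk1, LSwap_1])
  have S0 := sum_inv_aux (LRefl 0) i0 B (fun s hs => by rw [e0]; exact hinv1 s hs)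
  have S1 := sum_inv_aux (LRefl 1) i1 B (fun s hs => by rw [e1]; exact hinv2 s hs)
  have S2 := sum_inv_aux LSwap i2 B (fun s hs => by rw [e2]; exact hinv3 s hs)
  have A1 : (∑ s ∈ B, weight17 ρ B s * ρ ‖s‖ * s 0) = 0 := by
    have h := S0 (fun s => weight17 ρ B s * ρ ‖s‖ * s 0)
    simp [hw, LRefl_app] at h
    linarith
  have A2 : (∑ s ∈ B, weight17 ρ B s * ρ ‖s‖ * s 1) = 0 := by
    have h := S1 (fun s => weight17 ρ B s * ρ ‖s‖ * s 1)
    simp [hw, LRefl_app] at h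
    linarith
  have A3 : (∑ s ∈ B, weight17 ρ B s * ρ ‖s‖ * (s 0 * s 1)) = 0 := by
    have h := S0 (fun s => weight17 ρ B s * ρ ‖s‖ * (s 0 * s 1))
    simp [hw, LRefl_app] at h
    linarith
  have A4 : (∑ s ∈ B, weight17 ρ B s * ρ ‖s‖ * (s 0)^2) = 1 := by
    have : (∑ s ∈ B, weight17 ρ B s * ρ ‖s‖ * (s 0)^2)
        = (m22 ρ B + m40 ρ B) / (m22 ρ B + m40 ρ B) := by
      conv_rhs => rw [div_eq_mul_inv]
                  arg 1
                  rw [m22, m40, ← Finset.sum_add_distrib]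
      rw [Finset.sum_mul]
      refine Finset.sum_congr rfl fun s _ => ?_
      rw [weight17, normsq_aux]
      ring
    rw [this, div_self hpos.ne']
  have A5 : (∑ s ∈ B, weight17 ρ B s * ρ ‖s‖ * (s 1)^2) = 1 := by
    have h := S2 (fun s => weight17 ρ B s * ρ ‖s‖ * (s 0)^2)
    simp only [hw, LSwap_0, LinearIsometryEquiv.norm_map] at h
    rw [h, A4]
  have hint : IntegrableOn (fun s : EuclideanSpace ℝ (Fin 2) => ρ ‖s‖ * ‖s‖^2)
      (Metric.ball 0 1) := by
    by_contra h
    rw [integral_undef h] at hρ_mom2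
    norm_num at hρ_mom2
  have hi : ∀ i : Fin 2, IntegrableOn (fun s : EuclideanSpace ℝ (Fin 2) => ρ ‖s‖ * (s i * s i))
      (Metric.ball 0 1) := by
    intro i
    have hle : ∀ s : EuclideanSpace ℝ (Fin 2), s i * s i ≤ ‖s‖^2 := by
      intro s
      rw [normsq_aux]
      fin_cases i <;> simp <;> nlinarith [sq_nonneg (s 0), sq_nonneg (s 1)]
    have hm : AEStronglyMeasurable (fun s : EuclideanSpace ℝ (Fin 2) => ρ ‖s‖ * (s i * s i))
        (volume.restrict (Metric.ball 0 1)) := by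
      have hq : Measurable (fun s : EuclideanSpace ℝ (Fin 2) => s i * s i / ‖s‖^2) := by
        fun_prop
      refine (hint.aestronglyMeasurable.mul hq.aestronglyMeasurable).congr
        (Filter.Eventually.of_forall fun s => ?_)
      by_cases hs : s = 0
      · simp [hs]
      · have : ‖s‖ ≠ 0 := norm_ne_zero_iff.2 hs
        simp only [Pi.mul_apply]
        field_simp
    refine Integrable.mono' hint hm (Filter.Eventually.of_forall fun s => ?_)
    rw [Real.norm_of_nonneg (mul_nonneg (hρ_nonneg _) (mul_self_nonneg _))]
    exact mul_le_mul_of_nonneg_left (hle s) (hρ_nonneg _)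
  have J01 : ∫ s in Metric.ball (0 : EuclideanSpace ℝ (Fin 2)) 1, ρ ‖s‖ * (s 0 * s 1) = 0 := by
    have h := int_inv_aux (LRefl 0) (fun s => ρ ‖s‖ * (s 0 * s 1))
    simp [LRefl_app, integral_neg] at h
    linarith
  have Jeq : ∫ s in Metric.ball (0 : EuclideanSpace ℝ (Fin 2)) 1, ρ ‖s‖ * (s 1 * s 1)
      = ∫ s in Metric.ball (0 : EuclideanSpace ℝ (Fin 2)) 1, ρ ‖s‖ * (s 0 * s 0) := by
    have h := int_inv_aux LSwap (fun s => ρ ‖s‖ * (s 0 * s 0))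
    simpa only [LSwap_0, LinearIsometryEquiv.norm_map] using h
  have Jsum : (∫ s in Metric.ball (0 : EuclideanSpace ℝ (Fin 2)) 1, ρ ‖s‖ * (s 0 * s 0))
      + ∫ s in Metric.ball (0 : EuclideanSpace ℝ (Fin 2)) 1, ρ ‖s‖ * (s 1 * s 1) = 4 := by
    rw [← integral_add (hi 0) (hi 1), ← hρ_mom2]
    congr 1
    ext s
    rw [normsq_aux]; ring
  refine ⟨fun s _ => ?_, A1, A2, A3, A4, A5, ?_⟩
  · exact div_nonneg (mul_nonneg (phi_nonneg_aux _ (norm_nonneg _)) (sq_nonneg _)) hpos.le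
  · simp only [pow_two] at A4 A5
    have A3' : (∑ s ∈ B, weight17 ρ B s * ρ ‖s‖ * (s 1 * s 0)) = 0 := by
      simpa only [mul_comm] using A3
    have J10 : ∫ s in Metric.ball (0 : EuclideanSpace ℝ (Fin 2)) 1, ρ ‖s‖ * (s 1 * s 0) = 0 := by
      simpa only [mul_comm] using J01
    rw [Fin.forall_fin_two, Fin.forall_fin_two, Fin.forall_fin_two]
    refine ⟨⟨?_, ?_⟩, ?_, ?_⟩
    · rw [A4]; linarith
    · rw [A3, J01]; simp
    · rw [A3', J10]; simp
    · rw [A5]; linarith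

end
end
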